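/- For every ε = (ε₁, …, ε_n) ∈ {1, −1}^n, the set P^ε = P₁^{ε₁} ∪ ⋯ ∪ P_n^{ε_n} is the positive cone of a left-order on G = B_{n+1}: G is the disjoint union of P^ε, (P^ε)⁻¹ and {1}, and P^ε P^ε ⊆ P^ε. -/

import Mathlib

namespace GarsideOrder

variable {G : Type*} [Group G]

/-- `a ≤_R b` iff `b * a⁻¹ ∈ M`. -/
def leR (M : Submonoid G) (a b : G) : Prop := b * a⁻¹ ∈ M

/-- `a ≤_L b` iff `a⁻¹ * b ∈ M`. -/
def leL (M : Submonoid G) (a b : G) : Prop := a⁻¹ * b ∈ M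

/-- Right divisors (in `M`) of `a`. -/
def DivR (M : Submonoid G) (a : G) : Set G := {b : G | b ∈ M ∧ leR M b a}

/-- Left divisors (in `M`) of `a`. -/
def DivL (M : Submonoid G) (a : G) : Set G := {b : G | b ∈ M ∧ leL M b a}

/-- `a` is balanced if its sets of right and left divisors coincide. -/
def Balanced (M : Submonoid G) (a : G) : Prop := DivR M a = DivL M a

open Classical in
/-- The `N`-tail of `a`: the unique `b ∈ N` having the same right divisors lying in `N`
as `a` (w.r.t. the divisibility of the ambient monoid `M`). -/
noncomputable def tail (M N : Submonoid G) (a : G) : G :=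
  if h : ∃ b : G, b ∈ N ∧
      {c : G | c ∈ N ∧ leR M c a} = {c : G | c ∈ N ∧ leR M c b} then
    h.choose
  else 1

/-- Iterated stripping of alternating tails: first the `M₁`-tail, then the `N`-tail, etc. -/
noncomputable def strip (M M₁ N : Submonoid G) : ℕ → G → G
  | 0, a => a
  | i + 1, a =>
      strip M M₁ N i a *
        (tail M (if i % 2 = 0 then M₁ else N) (strip M M₁ N i a))⁻¹

/-- The breadth of `a`: the length of the alternating form of `a`, i.e. the least `p ≥ 1`
such that stripping alternating tails `p` times reaches `1`. -/
noncomputable def bh (M M₁ N : Submonoid G) (a : G) : ℕ :=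
  sInf {p : ℕ | 1 ≤ p ∧ strip M M₁ N p a = 1}

/-- The depth of `a`: `(bh a - 1)/2` if `bh a` is odd, `bh a / 2` if `bh a` is even;
in both cases this is `bh a / 2` with natural division. -/
noncomputable def dpt (M M₁ N : Submonoid G) (a : G) : ℕ := bh M M₁ N a / 2

/-- `a ∈ M` is unmovable if `Δ` does not right-divide it. -/
def Unmovable (M : Submonoid G) (Δ a : G) : Prop := a ∈ M ∧ ¬ leR M Δ a

/-- `α` is `(H, G₁)`-negative: its `Δ`-form is `a Δ^{-k}` with `k ≥ 1` and
`dpt a < dpt (Δ^k)`. -/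
def Negative (M M₁ N : Submonoid G) (Δ : G) (α : G) : Prop :=
  ∃ a : G, ∃ k : ℕ, Unmovable M Δ a ∧ 1 ≤ k ∧ α = a * (Δ ^ k)⁻¹ ∧
    dpt M M₁ N a < dpt M M₁ N (Δ ^ k)

/-- `α` is `(H, G₁)`-positive if `α⁻¹` is `(H, G₁)`-negative. -/
def Positive (M M₁ N : Submonoid G) (Δ : G) (α : G) : Prop :=
  Negative M M₁ N Δ α⁻¹

/-- The set `Θ` of theta elements `θ^k a₀`, `k ≥ 1`, `a₀ ∈ M₁`. -/
def thetaSet (M₁ : Submonoid G) (θ : G) : Set G :=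
  {x : G | ∃ k : ℕ, 1 ≤ k ∧ ∃ a₀ ∈ M₁, x = θ ^ k * a₀}

/-- `Θ̄ = Θ ∪ M₁`. -/
def thetaBar (M₁ : Submonoid G) (θ : G) : Set G := thetaSet M₁ θ ∪ (M₁ : Set G)

/-- Condition A with constant `ζ`: `dpt (Δ^k) = ζ k + 1` for all `k ≥ 1`. -/
def CondA (M M₁ N : Submonoid G) (Δ : G) (ζ : ℕ) : Prop :=
  ∀ k : ℕ, 1 ≤ k → dpt M M₁ N (Δ ^ k) = ζ * k + 1

/-- Condition B with constant `ζ`. -/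
def CondB (M M₁ N : Submonoid G) (Δ θ : G) (ζ : ℕ) : Prop :=
  ∀ a b c : G, ∀ t : ℤ,
    Unmovable M Δ a → Unmovable M Δ b →
    ¬(a ∈ thetaBar M₁ θ ∧ b ∈ thetaBar M₁ θ) →
    Unmovable M Δ c → a * b = c * Δ ^ t →
    ∃ ε : ℕ, ε ≤ 1 ∧
      (dpt M M₁ N c : ℤ) =
        (dpt M M₁ N a : ℤ) + (dpt M M₁ N b : ℤ) - (ζ : ℤ) * t - (ε : ℤ) ∧
      ((a ∈ thetaSet M₁ θ ∨ b ∈ thetaSet M₁ θ ∨ c ∈ M₁) → ε = 1)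

/-- A Garside structure with group of fractions the subgroup `car`. -/
structure IsGarsideOn (car : Subgroup G) (M : Submonoid G) (Δ : G) : Prop where
  M_sub : (M : Set G) ⊆ (car : Set G)
  delta_mem : Δ ∈ M
  units_trivial : ∀ x : G, x ∈ M → x⁻¹ ∈ M → x = 1
  noetherian : ∀ a ∈ M, ∃ n : ℕ, 1 ≤ n ∧ ∀ l : List G,
      (∀ x ∈ l, x ∈ M ∧ x ≠ 1) → l.prod = a → l.length ≤ n
  balanced : Balanced M Δ
  div_finite : (DivR M Δ).Finite
  div_gen_monoid : Submonoid.closure (DivR M Δ) = M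
  div_gen_group : Subgroup.closure (DivR M Δ) = car
  meet : ∀ a ∈ car, ∀ b ∈ car, ∃ c ∈ car, leR M c a ∧ leR M c b ∧
      ∀ d ∈ car, leR M d a → leR M d b → leR M d c
  join : ∀ a ∈ car, ∀ b ∈ car, ∃ c ∈ car, leR M a c ∧ leR M b c ∧
      ∀ d ∈ car, leR M a d → leR M b d → leR M c d

/-- The parabolic submonoid determined by `δ`: the submonoid generated by `Div(δ)`. -/
def parM (M : Submonoid G) (δ : G) : Submonoid G := Submonoid.closure (DivR M δ)

/-- The parabolic subgroup determined by `δ`: the subgroup generated by `Div(δ)`. -/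
def parG (M : Submonoid G) (δ : G) : Subgroup G := Subgroup.closure (DivR M δ)

/-- `δ` determines a parabolic substructure of `(G, M, Δ)`. -/
structure IsParabolic (M : Submonoid G) (Δ δ : G) : Prop where
  mem : δ ∈ M
  balanced : Balanced M δ
  div_eq : DivR M δ = DivR M Δ ∩ (parM M δ : Set G)

/-- The setting of Section 3: a Garside structure `(car, M, Δ)` together with two
parabolic substructures `(H, N, Λ)` (given by `lam`) and `(G₁, M₁, Δ₁)` (given by `δ1`),
with `N ≠ M`, `M₁ ≠ M`, `N ∪ M₁` generating `M`, `Δ` central, `Δ₁` central in `G₁`. -/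
structure Setting (G : Type*) [Group G] where
  car : Subgroup G
  M : Submonoid G
  Δ : G
  δ1 : G
  lam : G
  garside : IsGarsideOn car M Δ
  par1 : IsParabolic M Δ δ1
  parH : IsParabolic M Δ lam
  N_ne : parM M lam ≠ M
  M1_ne : parM M δ1 ≠ M
  unionGen : Submonoid.closure ((parM M lam : Set G) ∪ (parM M δ1 : Set G)) = M
  delta_central : ∀ g ∈ car, Δ * g = g * Δ
  delta1_central : ∀ g ∈ parG M δ1, δ1 * g = g * δ1

namespace Setting

variable (S : Setting G)

/-- The parabolic submonoid `M₁`. -/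
def M₁ : Submonoid G := parM S.M S.δ1

/-- The parabolic submonoid `N`. -/
def Nsub : Submonoid G := parM S.M S.lam

/-- The parabolic subgroup `G₁`. -/
def G₁ : Subgroup G := parG S.M S.δ1

/-- `θ = Δ Δ₁⁻¹`. -/
def theta : G := S.Δ * S.δ1⁻¹

/-- The set of `(H, G₁)`-negative elements. -/
def Neg : Set G := {α : G | Negative S.M S.M₁ S.Nsub S.Δ α}

/-- The set of `(H, G₁)`-positive elements. -/
def Pos : Set G := {α : G | α⁻¹ ∈ S.Neg}

/-- Condition A. -/
def condA (ζ : ℕ) : Prop := CondA S.M S.M₁ S.Nsub S.Δ ζ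

/-- Condition B. -/
def condB (ζ : ℕ) : Prop := CondB S.M S.M₁ S.Nsub S.Δ S.theta ζ

/-- `(H, G₁)` is a Dehornoy structure: `PP ⊆ P`, `G₁ P G₁ ⊆ P`, and the group is the
disjoint union of `P`, `P⁻¹` and `G₁`. -/
def IsDehornoy : Prop :=
  (∀ α ∈ S.Pos, ∀ β ∈ S.Pos, α * β ∈ S.Pos) ∧
  (∀ g₁ ∈ S.G₁, ∀ α ∈ S.Pos, ∀ g₂ ∈ S.G₁, g₁ * α * g₂ ∈ S.Pos) ∧
  (∀ α ∈ S.car, α ∈ S.Pos ∨ α ∈ S.Neg ∨ α ∈ S.G₁) ∧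
  (∀ α : G, ¬(α ∈ S.Pos ∧ α ∈ S.Neg)) ∧
  (∀ α : G, ¬(α ∈ S.Pos ∧ α ∈ S.G₁)) ∧
  (∀ α : G, ¬(α ∈ S.Neg ∧ α ∈ S.G₁))

end Setting

end GarsideOrder


namespace BraidOrder

open GarsideOrder

/-- The braid relations on `n` generators `σ_0, …, σ_{n-1}` (representing `s_1, …, s_n`). -/
def braidRel (n : ℕ) : Set (FreeGroup (Fin n)) :=
  {r | ∃ i j : Fin n,
      ((i : ℕ) + 1 = (j : ℕ) ∧
        r = FreeGroup.of i * FreeGroup.of j * FreeGroup.of i *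
            (FreeGroup.of j * FreeGroup.of i * FreeGroup.of j)⁻¹) ∨
      ((i : ℕ) + 2 ≤ (j : ℕ) ∧
        r = FreeGroup.of i * FreeGroup.of j * (FreeGroup.of j * FreeGroup.of i)⁻¹)}

/-- The braid group `B_{n+1}` on `n+1` strands, presented with `n` generators. -/
abbrev Braid (n : ℕ) := PresentedGroup (braidRel n)

/-- `gen n i` is the generator `s_{i+1}` of `B_{n+1}` (for `i < n`). -/
def gen (n i : ℕ) : Braid n :=
  if h : i < n then PresentedGroup.of ⟨i, h⟩ else 1

/-- The product `gen a * gen (a+1) * ⋯ * gen (b-1)`, i.e. `s_{a+1} s_{a+2} ⋯ s_b`. -/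
def seg (n a b : ℕ) : Braid n := (((List.range b).drop a).map (gen n)).prod

/-- The product `gen (b-1) * ⋯ * gen (a+1) * gen a`, i.e. `s_b ⋯ s_{a+2} s_{a+1}`. -/
def segRev (n a b : ℕ) : Braid n := ((((List.range b).drop a).reverse).map (gen n)).prod

/-- The positive braid monoid `B_{n+1}^+`. -/
def Mb (n : ℕ) : Submonoid (Braid n) :=
  Submonoid.closure {x : Braid n | ∃ i : ℕ, i < n ∧ x = gen n i}

/-- The submonoid generated by `s_2, …, s_n`. -/
def M₁b (n : ℕ) : Submonoid (Braid n) :=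
  Submonoid.closure {x : Braid n | ∃ i : ℕ, 1 ≤ i ∧ i < n ∧ x = gen n i}

/-- The submonoid generated by `s_1, …, s_{n-1}`. -/
def Nb (n : ℕ) : Submonoid (Braid n) :=
  Submonoid.closure {x : Braid n | ∃ i : ℕ, i + 1 < n ∧ x = gen n i}

/-- The subgroup generated by `s_2, …, s_n`. -/
def G₁b (n : ℕ) : Subgroup (Braid n) :=
  Subgroup.closure {x : Braid n | ∃ i : ℕ, 1 ≤ i ∧ i < n ∧ x = gen n i}

/-- The subgroup generated by `s_1, …, s_{n-1}`. -/
def Hb (n : ℕ) : Subgroup (Braid n) :=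
  Subgroup.closure {x : Braid n | ∃ i : ℕ, i + 1 < n ∧ x = gen n i}

/-- The Garside element `Δ = (s_1 s_2 ⋯ s_n)^{n+1}`. -/
def Δb (n : ℕ) : Braid n := seg n 0 n ^ (n + 1)

/-- `Δ₁ = (s_2 ⋯ s_n)^n`. -/
def Δ₁b (n : ℕ) : Braid n := seg n 1 n ^ n

/-- `Λ = (s_1 ⋯ s_{n-1})^n`. -/
def Λb (n : ℕ) : Braid n := seg n 0 (n - 1) ^ n

/-- `θ = s_1 ⋯ s_{n-1} s_n² s_{n-1} ⋯ s_1` as an explicit word. -/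
def thetaWordb (n : ℕ) : Braid n := seg n 0 n * segRev n 0 n

end BraidOrder

namespace BraidOrder

open GarsideOrder

/-- The submonoid of `B_{n+1}^+` generated by `s_{i+1}, …, s_n`. -/
def Mi (n i : ℕ) : Submonoid (Braid n) :=
  Submonoid.closure {x : Braid n | ∃ j : ℕ, i ≤ j ∧ j < n ∧ x = gen n j}

/-- The submonoid generated by `s_i, …, s_{n-1}`. -/
def Ni (n i : ℕ) : Submonoid (Braid n) :=
  Submonoid.closure {x : Braid n | ∃ j : ℕ, i ≤ j + 1 ∧ j + 1 < n ∧ x = gen n j}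

/-- `Δ_i = (s_{i+1} ⋯ s_n)^{n+1-i}`. -/
def Δi (n i : ℕ) : Braid n := seg n i n ^ (n + 1 - i)

/-- `P_i` (for `1 ≤ i ≤ n-1`): the `(H_i, G_i)`-positive elements of `G_{i-1}`;
`P_n = {s_n^k | k ≥ 1}`. -/
noncomputable def PiSet (n i : ℕ) : Set (Braid n) :=
  if i = n then {x : Braid n | ∃ k : ℕ, 1 ≤ k ∧ x = gen n (n - 1) ^ k}
  else {α : Braid n | Negative (Mi n (i - 1)) (Mi n i) (Ni n i) (Δi n (i - 1)) α⁻¹}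

end BraidOrder

/-! ### The positive braid monoid on infinitely many strands -/

namespace BraidWord

/-- Two letters commute. -/
def Far (i j : ℕ) : Prop := i + 2 ≤ j ∨ j + 2 ≤ i

/-- Two letters satisfy the braid relation. -/
def Adj (i j : ℕ) : Prop := i + 1 = j ∨ j + 1 = i

theorem Far.symm {i j : ℕ} (h : Far i j) : Far j i := Or.symm h

theorem Adj.symm {i j : ℕ} (h : Adj i j) : Adj j i := Or.symm h

/-- Equivalence of positive braid words. -/
inductive BEq : List ℕ → List ℕ → Prop
  | refl (u) : BEq u u
  | symm {u v} : BEq u v → BEq v u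
  | trans {u v w} : BEq u v → BEq v w → BEq u w
  | cons (i) {u v} : BEq u v → BEq (i :: u) (i :: v)
  | comm {i j} (u) : Far i j → BEq (i :: j :: u) (j :: i :: u)
  | braid {i j} (u) : Adj i j → BEq (i :: j :: i :: u) (j :: i :: j :: u)

namespace BEq

theorem length_eq {u v : List ℕ} (h : BEq u v) : u.length = v.length := by
  induction h <;> simp_all

theorem mem_iff {u v : List ℕ} (h : BEq u v) (k : ℕ) : k ∈ u ↔ k ∈ v := by
  induction h <;> simp_all <;> tauto

theorem append_right {u v : List ℕ} (h : BEq u v) (w : List ℕ) : BEq (u ++ w) (v ++ w) := by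
  induction h with
  | refl u => exact .refl _
  | symm _ ih => exact ih.symm
  | trans _ _ ih₁ ih₂ => exact ih₁.trans ih₂
  | cons i _ ih => exact ih.cons i
  | comm u h => exact .comm _ h
  | braid u h => exact .braid _ h

theorem append_left (w : List ℕ) {u v : List ℕ} (h : BEq u v) : BEq (w ++ u) (w ++ v) := by
  induction w with
  | nil => exact h
  | cons i w ih => exact ih.cons i

theorem reverse {u v : List ℕ} (h : BEq u v) : BEq u.reverse v.reverse := by
  induction h with
  | refl u => exact .refl _
  | symm _ ih => exact ih.symm
  | trans _ _ ih₁ ih₂ => exact ih₁.trans ih₂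
  | cons i _ ih => simpa using ih.append_right [i]
  | comm u h => simpa using append_left u.reverse (BEq.comm [] h.symm)
  | braid u h => simpa using append_left u.reverse (BEq.braid [] h)

end BEq

/-- Braid equivalence as a congruence. -/
def braidCon : Con (FreeMonoid ℕ) where
  r u v := BEq u.toList v.toList
  iseqv := ⟨fun _ => .refl _, fun h => h.symm, fun h₁ h₂ => h₁.trans h₂⟩
  mul' h₁ h₂ := (h₁.append_right _).trans (h₂.append_left _)

/-- The positive braid monoid on infinitely many strands. -/
abbrev Pos : Type := braidCon.Quotient

/-- The element represented by a word. -/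
def mk (u : List ℕ) : Pos := ((FreeMonoid.ofList u : FreeMonoid ℕ) : braidCon.Quotient)

/-- The generators. -/
def σ (i : ℕ) : Pos := mk [i]

theorem mk_eq {u v : List ℕ} : mk u = mk v ↔ BEq u v := Con.eq braidCon

theorem mk_append (u v : List ℕ) : mk (u ++ v) = mk u * mk v := rfl

theorem mk_cons (i : ℕ) (u : List ℕ) : mk (i :: u) = σ i * mk u := rfl

theorem mk_nil : mk [] = 1 := rfl

theorem mk_surj (x : Pos) : ∃ u, mk u = x := Quotient.exists_rep x

theorem σ_comm {i j : ℕ} (h : Far i j) (x : Pos) : σ i * (σ j * x) = σ j * (σ i * x) := by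
  obtain ⟨u, rfl⟩ := mk_surj x
  exact mk_eq.2 (.comm u h)

theorem σ_braid {i j : ℕ} (h : Adj i j) (x : Pos) :
    σ i * (σ j * (σ i * x)) = σ j * (σ i * (σ j * x)) := by
  obtain ⟨u, rfl⟩ := mk_surj x
  exact mk_eq.2 (.braid u h)

/-- The length of a positive braid. -/
def len (x : Pos) : ℕ := Quotient.lift (fun u : FreeMonoid ℕ => u.toList.length)
  (fun _ _ h => BEq.length_eq h) x

theorem len_mk (u : List ℕ) : len (mk u) = u.length := rfl

theorem len_σ_mul (i : ℕ) (x : Pos) : len (σ i * x) = len x + 1 := by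
  obtain ⟨u, rfl⟩ := mk_surj x
  rw [← mk_cons, len_mk, len_mk, List.length_cons]

/-- The expected conclusion from `σ a * x = σ b * y`. -/
def Lcm (a b : ℕ) (x y : Pos) : Prop :=
  (a = b ∧ x = y) ∨ (Far a b ∧ ∃ z, x = σ b * z ∧ y = σ a * z) ∨
    (Adj a b ∧ ∃ z, x = σ b * (σ a * z) ∧ y = σ a * (σ b * z))

theorem Lcm.symm {a b : ℕ} {x y : Pos} (h : Lcm a b x y) : Lcm b a y x := by
  rcases h with ⟨rfl, rfl⟩ | ⟨h, z, rfl, rfl⟩ | ⟨h, z, rfl, rfl⟩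
  · exact .inl ⟨rfl, rfl⟩
  · exact .inr (.inl ⟨h.symm, z, rfl, rfl⟩)
  · exact .inr (.inr ⟨h.symm, z, rfl, rfl⟩)

/-- The lcm property for words shorter than `l`. -/
def LcmBelow (l : ℕ) : Prop :=
  ∀ a b x y, len x < l → σ a * x = σ b * y → Lcm a b x y

theorem LcmBelow.eq_of_eq {l : ℕ} (P : LcmBelow l) {a : ℕ} {x y : Pos} (hl : len x < l)
    (h : σ a * x = σ a * y) : x = y := by
  rcases P _ _ _ _ hl h with h | h | h
  · exact h.2
  · rcases h.1 with h | h <;> omega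
  · rcases h.1 with h | h <;> omega

theorem LcmBelow.of_far {l : ℕ} (P : LcmBelow l) {a b : ℕ} {x y : Pos} (hl : len x < l)
    (hab : Far a b) (h : σ a * x = σ b * y) : ∃ z, x = σ b * z ∧ y = σ a * z := by
  rcases P _ _ _ _ hl h with h | h | h
  · rcases hab with h' | h' <;> omega
  · exact h.2
  · rcases h.1 with h | h <;> rcases hab with h' | h' <;> omega

theorem LcmBelow.of_adj {l : ℕ} (P : LcmBelow l) {a b : ℕ} {x y : Pos} (hl : len x < l)
    (hab : Adj a b) (h : σ a * x = σ b * y) :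
    ∃ z, x = σ b * (σ a * z) ∧ y = σ a * (σ b * z) := by
  rcases P _ _ _ _ hl h with h | h | h
  · rcases hab with h' | h' <;> omega
  · rcases h.1 with h | h <;> rcases hab with h' | h' <;> omega
  · exact h.2

theorem far_or_adj (a b : ℕ) : a = b ∨ Far a b ∨ Adj a b := by
  unfold Far Adj; omega

theorem Lcm.trans_far_far {l a b c : ℕ} (P : LcmBelow l) {u v : Pos} (hac : Far a c)
    (hcb : Far c b) (hl : len u < l) (h : σ a * u = σ b * v) :
    Lcm a b (σ c * u) (σ c * v) := by
  rcases P _ _ _ _ hl h with ⟨rfl, rfl⟩ | ⟨hab, t, rfl, rfl⟩ | ⟨hab, t, rfl, rfl⟩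
  · exact .inl ⟨rfl, rfl⟩
  · refine .inr (.inl ⟨hab, σ c * t, ?_, ?_⟩)
    · rw [σ_comm hcb]
    · rw [σ_comm hac]
  · refine .inr (.inr ⟨hab, σ c * t, ?_, ?_⟩)
    · rw [σ_comm hcb, σ_comm hac]
    · rw [← σ_comm hac, σ_comm hcb]

theorem Lcm.trans_adj_far {l a b c : ℕ} (P : LcmBelow l) {u v : Pos} (hac : Adj a c)
    (hcb : Far c b) (hl : len u + 1 < l) (h : σ a * (σ c * u) = σ b * v) :
    Lcm a b (σ c * (σ a * u)) (σ c * v) := by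
  have hl' : len (σ c * u) < l := by rw [len_σ_mul]; exact hl
  rcases P _ _ _ _ hl' h with ⟨rfl, -⟩ | ⟨hab, t, h₁, rfl⟩ | ⟨hab, t, h₁, rfl⟩
  · rcases hac with h | h <;> rcases hcb with h' | h' <;> omega
  · obtain ⟨s, rfl, rfl⟩ := P.of_far (by omega) hcb h₁
    refine .inr (.inl ⟨hab, σ c * (σ a * s), ?_, ?_⟩)
    · rw [σ_comm hab, σ_comm hcb]
    · rw [σ_braid hac]
  · obtain ⟨s, rfl, h₂⟩ := P.of_far (by omega) hcb h₁
    rw [len_σ_mul] at hl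
    have hl₂ : len (σ a * t) < l := by rw [h₂, len_σ_mul]; omega
    rw [len_σ_mul] at hl₂
    obtain ⟨r, rfl, rfl⟩ := P.of_adj (by omega) hac h₂
    refine .inr (.inr ⟨hab, σ c * (σ a * (σ b * r)), ?_, ?_⟩)
    · rw [σ_braid hab, σ_comm hcb, ← σ_comm hcb r, ← σ_braid hac]
    · rw [← σ_comm hcb, ← σ_braid hac, σ_braid hab, σ_comm hcb]

theorem Lcm.trans_adj_adj {l a b c : ℕ} (P : LcmBelow l) {u v : Pos} (hac : Adj a c)
    (hcb : Adj c b) (hl : len u + 1 < l) (h : σ a * (σ c * u) = σ b * (σ c * v)) :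
    Lcm a b (σ c * (σ a * u)) (σ c * (σ b * v)) := by
  have hl' : len (σ c * u) < l := by rw [len_σ_mul]; exact hl
  have hlv : len u = len v := by
    have := congrArg len h
    simp only [len_σ_mul] at this
    omega
  have hab : a = b ∨ Far a b := by unfold Far; unfold Adj at hac hcb; omega
  rcases hab with rfl | hab
  · obtain rfl := P.eq_of_eq (by omega) (P.eq_of_eq hl' h)
    exact .inl ⟨rfl, rfl⟩
  · obtain ⟨t, h₁, h₂⟩ := P.of_far hl' hab h
    obtain ⟨s, rfl, rfl⟩ := P.of_adj (by omega) hcb h₁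
    obtain ⟨r, rfl, h₃⟩ := P.of_adj (by omega) hac.symm h₂
    simp only [len_σ_mul] at hl hlv
    have h₄ := P.eq_of_eq (by simp only [len_σ_mul]; omega) h₃
    obtain ⟨q, rfl, rfl⟩ := P.of_far (by omega) hab.symm h₄
    refine .inr (.inl ⟨hab, σ c * (σ b * (σ a * (σ c * q))), ?_, ?_⟩)
    · rw [σ_comm hab, σ_braid hac, σ_braid hcb]
    · rw [← σ_comm hab, ← σ_braid hcb, ← σ_braid hac, σ_comm hab]

theorem Lcm.trans {l a b c : ℕ} (P : LcmBelow l) {x w y : Pos} (hl : len w ≤ l)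
    (h₁ : Lcm a c x w) (h₂ : Lcm c b w y) : Lcm a b x y := by
  rcases h₁ with ⟨rfl, rfl⟩ | ⟨hac, u, rfl, rfl⟩ | ⟨hac, u, rfl, rfl⟩
  · exact h₂
  · rcases h₂ with ⟨rfl, rfl⟩ | ⟨hcb, v, h, rfl⟩ | ⟨hcb, v, h, rfl⟩
    · exact .inr (.inl ⟨hac, u, rfl, rfl⟩)
    · rw [len_σ_mul] at hl
      exact Lcm.trans_far_far P hac hcb (by omega) h
    · rw [h] at hl
      simp only [len_σ_mul] at hl
      exact (Lcm.trans_adj_far P hcb.symm hac.symm (by omega) h.symm).symm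
  · rcases h₂ with ⟨rfl, rfl⟩ | ⟨hcb, v, h, rfl⟩ | ⟨hcb, v, h, rfl⟩
    · exact .inr (.inr ⟨hac, u, rfl, rfl⟩)
    · simp only [len_σ_mul] at hl
      exact Lcm.trans_adj_far P hac hcb (by omega) h
    · simp only [len_σ_mul] at hl
      exact Lcm.trans_adj_adj P hac hcb (by omega) h

/-- Equivalent nonempty words satisfy the lcm property. -/
def Good : List ℕ → List ℕ → Prop
  | a :: u, b :: v => Lcm a b (mk u) (mk v)
  | _, _ => True

theorem lcmBelow (l : ℕ) : LcmBelow l := by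
  induction l with
  | zero => intro _ _ _ _ h; omega
  | succ l P =>
    have key : ∀ u v, BEq u v → u.length ≤ l + 1 → Good u v := by
      intro u v h
      induction h with
      | refl u =>
        intro _
        cases u with
        | nil => trivial
        | cons => exact .inl ⟨rfl, rfl⟩
      | @symm u v h ih =>
        intro hl
        rw [← h.length_eq] at hl
        rcases u with _ | ⟨a, u⟩ <;> rcases v with _ | ⟨b, v⟩ <;> try trivial
        exact (ih hl).symm
      | @trans u w v h₁ h₂ ih₁ ih₂ =>
        intro hl
        have e₁ := h₁.length_eq
        have e₂ := h₂.length_eq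
        rcases u with _ | ⟨a, u⟩ <;> rcases w with _ | ⟨c, w⟩ <;> rcases v with _ | ⟨b, v⟩ <;>
          first | trivial | (simp at e₁; done) | (simp at e₂; done) | skip
        refine Lcm.trans P ?_ (ih₁ hl) (ih₂ (by omega))
        rw [len_mk]
        simp only [List.length_cons] at hl e₁
        omega
      | cons i h _ => exact fun _ => .inl ⟨rfl, mk_eq.2 h⟩
      | comm u h => exact fun _ => .inr (.inl ⟨h, mk u, rfl, rfl⟩)
      | braid u h => exact fun _ => .inr (.inr ⟨h, mk u, rfl, rfl⟩)
    intro a b x y hl h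
    obtain ⟨u, rfl⟩ := mk_surj x
    obtain ⟨v, rfl⟩ := mk_surj y
    exact key (a :: u) (b :: v) (mk_eq.1 h) (by rw [len_mk] at hl; simp; omega)

theorem lcm_left {a b : ℕ} {x y : Pos} (h : σ a * x = σ b * y) : Lcm a b x y :=
  lcmBelow _ _ _ _ _ (Nat.lt_succ_self _) h

theorem BEq.lcm_left {a b : ℕ} {u v : List ℕ} (h : BEq (a :: u) (b :: v)) :
    (a = b ∧ BEq u v) ∨ (Far a b ∧ ∃ w, BEq u (b :: w) ∧ BEq v (a :: w)) ∨
      (Adj a b ∧ ∃ w, BEq u (b :: a :: w) ∧ BEq v (a :: b :: w)) := by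
  have h' : σ a * mk u = σ b * mk v := mk_eq.2 h
  rcases BraidWord.lcm_left h' with
    ⟨e, h⟩ | ⟨e, z, h₁, h₂⟩ | ⟨e, z, h₁, h₂⟩
  · exact .inl ⟨e, mk_eq.1 h⟩
  · obtain ⟨w, rfl⟩ := mk_surj z
    exact .inr (.inl ⟨e, w, mk_eq.1 h₁, mk_eq.1 h₂⟩)
  · obtain ⟨w, rfl⟩ := mk_surj z
    exact .inr (.inr ⟨e, w, mk_eq.1 h₁, mk_eq.1 h₂⟩)

theorem BEq.lcm_right {a b : ℕ} {u v : List ℕ} (h : BEq (u ++ [a]) (v ++ [b])) :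
    (a = b ∧ BEq u v) ∨ (Far a b ∧ ∃ w, BEq u (w ++ [b]) ∧ BEq v (w ++ [a])) ∨
      (Adj a b ∧ ∃ w, BEq u (w ++ [a, b]) ∧ BEq v (w ++ [b, a])) := by
  have h' : BEq (a :: u.reverse) (b :: v.reverse) := by simpa using h.reverse
  rcases h'.lcm_left with ⟨e, h⟩ | ⟨e, w, h₁, h₂⟩ | ⟨e, w, h₁, h₂⟩
  · exact .inl ⟨e, by simpa using h.reverse⟩
  · exact .inr (.inl ⟨e, w.reverse, by simpa using h₁.reverse, by simpa using h₂.reverse⟩)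
  · exact .inr (.inr ⟨e, w.reverse, by simpa using h₁.reverse, by simpa using h₂.reverse⟩)

end BraidWord

/-! ### Identities following from the braid relations -/

namespace BraidWord

/-- The braid relations for a sequence of elements of a monoid. -/
structure Rels {M : Type*} [Monoid M] (s : ℕ → M) (n : ℕ) : Prop where
  comm : ∀ {i j}, i + 2 ≤ j → j < n → s i * s j = s j * s i
  braid : ∀ {i}, i + 1 < n → s i * s (i + 1) * s i = s (i + 1) * s i * s (i + 1)

/-- The ascending product `s 0 * s 1 * ⋯ * s (m - 1)`. -/
def asc {M : Type*} [Monoid M] (s : ℕ → M) : ℕ → M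
  | 0 => 1
  | m + 1 => asc s m * s m

/-- The descending product `s (m - 1) * ⋯ * s 1 * s 0`. -/
def desc {M : Type*} [Monoid M] (s : ℕ → M) : ℕ → M
  | 0 => 1
  | m + 1 => s m * desc s m

section Rels

variable {M : Type*} [Monoid M] {s : ℕ → M} {n : ℕ}

theorem asc_succ' (s : ℕ → M) (m : ℕ) : asc s (m + 1) = s 0 * asc (fun i => s (i + 1)) m := by
  induction m with
  | zero => simp [asc]
  | succ m ih => rw [asc, ih, asc, mul_assoc]

theorem desc_succ' (s : ℕ → M) (m : ℕ) : desc s (m + 1) = desc (fun i => s (i + 1)) m * s 0 := by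
  induction m with
  | zero => simp [desc]
  | succ m ih => rw [desc, ih, desc, mul_assoc]

theorem asc_mem {s : ℕ → M} {A : Set ℕ} {m : ℕ} (h : ∀ i < m, i ∈ A) :
    asc s m ∈ Submonoid.closure (s '' A) := by
  induction m with
  | zero => exact one_mem _
  | succ m ih =>
    exact mul_mem (ih fun i hi => h i (by omega))
      (Submonoid.subset_closure ⟨m, h m (by omega), rfl⟩)

theorem desc_mem {s : ℕ → M} {A : Set ℕ} {m : ℕ} (h : ∀ i < m, i ∈ A) :
    desc s m ∈ Submonoid.closure (s '' A) := by
  induction m with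
  | zero => exact one_mem _
  | succ m ih =>
    exact mul_mem (Submonoid.subset_closure ⟨m, h m (by omega), rfl⟩)
      (ih fun i hi => h i (by omega))

namespace Rels

theorem comm' (R : Rels s n)
    {i j : ℕ} (hi : i < n) (hj : j < n) (h : Far i j) : s i * s j = s j * s i := by
  rcases h with h | h
  · exact R.comm h hj
  · exact (R.comm h hi).symm

theorem braid' (R : Rels s n) {i j : ℕ} (hi : i < n) (hj : j < n) (h : Adj i j) :
    s i * s j * s i = s j * s i * s j := by
  rcases h with rfl | rfl
  · exact R.braid hj
  · exact (R.braid hi).symm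

theorem shift (R : Rels s n) (p : ℕ) : Rels (fun i => s (p + i)) (n - p) where
  comm h₁ h₂ := R.comm (by omega) (by omega)
  braid h := R.braid (by omega)

theorem asc_comm (R : Rels s n)
    {j m : ℕ} (h : m < j) (hj : j < n) : asc s m * s j = s j * asc s m := by
  induction m with
  | zero => simp [asc]
  | succ m ih =>
    rw [asc, mul_assoc, R.comm (by omega) hj, ← mul_assoc, ih (by omega), mul_assoc]

theorem desc_comm (R : Rels s n)
    {j m : ℕ} (h : m < j) (hj : j < n) : desc s m * s j = s j * desc s m := by
  induction m with
  | zero => simp [desc]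
  | succ m ih =>
    rw [desc, mul_assoc, ih (by omega), ← mul_assoc, R.comm (by omega) hj, mul_assoc]

theorem asc_mul (R : Rels s n) {i m : ℕ} (hi : i + 1 < m) (hm : m ≤ n) :
    asc s m * s i = s (i + 1) * asc s m := by
  induction m with
  | zero => omega
  | succ m ih =>
    rcases Nat.lt_or_ge (i + 1) m with h | h
    · rw [asc, mul_assoc, ← R.comm (by omega) (by omega), ← mul_assoc, ih h (by omega), mul_assoc]
    · obtain rfl : m = i + 1 := by omega
      rw [asc, asc, mul_assoc, mul_assoc, ← mul_assoc (s i), R.braid (by omega), ← mul_assoc,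
        ← mul_assoc, R.asc_comm (by omega) (by omega), mul_assoc, mul_assoc, mul_assoc]

theorem mul_desc (R : Rels s n) {i m : ℕ} (hi : i + 1 < m) (hm : m ≤ n) :
    s i * desc s m = desc s m * s (i + 1) := by
  induction m with
  | zero => omega
  | succ m ih =>
    rcases Nat.lt_or_ge (i + 1) m with h | h
    · rw [desc, ← mul_assoc, R.comm (by omega) (by omega), mul_assoc, ih h (by omega), mul_assoc]
    · obtain rfl : m = i + 1 := by omega
      rw [desc, desc, ← mul_assoc, ← mul_assoc, R.braid (by omega), mul_assoc,
        ← R.desc_comm (by omega) (by omega), mul_assoc, mul_assoc, mul_assoc]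

theorem asc_pow_mul (R : Rels s n) {i k : ℕ} (h : i + k < n) :
    asc s n ^ k * s i = s (i + k) * asc s n ^ k := by
  induction k with
  | zero => simp
  | succ k ih =>
    rw [pow_succ', mul_assoc, ih (by omega), ← mul_assoc, R.asc_mul (by omega) le_rfl, mul_assoc]
    rfl

theorem asc_mul_asc (R : Rels s n) {k : ℕ} (h : k < n) :
    asc s n * asc s k = asc (fun i => s (i + 1)) k * asc s n := by
  induction k with
  | zero => simp [asc]
  | succ k ih =>
    rw [asc, ← mul_assoc, ih (by omega), mul_assoc, R.asc_mul h le_rfl, asc, mul_assoc]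

theorem zero_mul_asc_sq (R : Rels s n) {m : ℕ} (hm : n = m + 1) :
    s 0 * asc s n ^ 2 = asc s n ^ 2 * s m := by
  subst hm
  have h : s 0 * (asc s (m + 1) * asc s m) = asc s (m + 1) ^ 2 := by
    rw [R.asc_mul_asc (by omega), ← mul_assoc, ← asc_succ', sq]
  have e : asc s (m + 1) ^ 2 = asc s (m + 1) * asc s m * s m := by rw [sq, mul_assoc]; rfl
  calc s 0 * asc s (m + 1) ^ 2 = s 0 * (asc s (m + 1) * asc s m) * s m := by
        rw [e, mul_assoc (s 0)]
    _ = asc s (m + 1) ^ 2 * s m := by rw [h]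

theorem asc_pow_central (R : Rels s n) {i : ℕ} (hi : i < n) :
    asc s n ^ (n + 1) * s i = s i * asc s n ^ (n + 1) := by
  obtain ⟨m, rfl⟩ : ∃ m, n = m + 1 := ⟨n - 1, by omega⟩
  have e : m + 1 + 1 = i + 2 + (m - i) := by omega
  have h₁ := R.asc_pow_mul (i := i) (k := m - i) (by omega)
  have h₂ := R.asc_pow_mul (i := 0) (k := i) (by omega)
  rw [show i + (m - i) = m by omega] at h₁
  rw [zero_add] at h₂
  rw [e, pow_add, mul_assoc, h₁, ← mul_assoc, pow_add, mul_assoc (asc s (m + 1) ^ i),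
    ← R.zero_mul_asc_sq rfl, ← mul_assoc, h₂, mul_assoc, mul_assoc, mul_assoc]

theorem dvd_asc_pow (R : Rels s n) {i : ℕ} (hi : i < n) :
    ∃ y ∈ Submonoid.closure (s '' Set.Iio n), asc s n ^ (n + 1) = s i * y := by
  obtain ⟨m, rfl⟩ : ∃ m, n = m + 1 := ⟨n - 1, by omega⟩
  have h₂ := R.asc_pow_mul (i := 0) (k := i) (by omega)
  rw [zero_add] at h₂
  have hc : asc s (m + 1) ∈ Submonoid.closure (s '' Set.Iio (m + 1)) := asc_mem fun i hi => hi
  have hc' : asc (fun i => s (i + 1)) m ∈ Submonoid.closure (s '' Set.Iio (m + 1)) := by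
    refine (Submonoid.closure_mono ?_) (asc_mem (A := Set.Iio m) fun i hi => hi)
    rintro _ ⟨j, hj, rfl⟩
    exact ⟨j + 1, Nat.succ_lt_succ hj, rfl⟩
  refine ⟨asc s (m + 1) ^ i * asc (fun i => s (i + 1)) m * asc s (m + 1) ^ (m + 1 - i),
    mul_mem (mul_mem (pow_mem hc _) hc') (pow_mem hc _), ?_⟩
  rw [← mul_assoc, ← mul_assoc, ← h₂, mul_assoc (asc s (m + 1) ^ i), ← asc_succ', ← pow_succ,
    ← pow_add]
  congr 1
  omega

end Rels

end Rels

/-! ### Embedding the positive braid monoid in a group -/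

theorem σ_mul_left_cancel {i : ℕ} {x y : Pos} (h : σ i * x = σ i * y) : x = y :=
  (lcmBelow _).eq_of_eq (Nat.lt_succ_self _) h

theorem σ_mul_right_cancel {i : ℕ} {x y : Pos} (h : x * σ i = y * σ i) : x = y := by
  obtain ⟨u, rfl⟩ := mk_surj x
  obtain ⟨v, rfl⟩ := mk_surj y
  have h' : BEq (u ++ [i]) (v ++ [i]) := mk_eq.1 h
  rcases h'.lcm_right with h | h | h
  · exact mk_eq.2 h.2
  · rcases h.1 with h | h <;> omega
  · rcases h.1 with h | h <;> omega

instance : IsLeftCancelMul Pos where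
  mul_left_cancel x y z h := by
    obtain ⟨u, rfl⟩ := mk_surj x
    induction u with
    | nil => simpa [mk_nil] using h
    | cons i u ih =>
      simp only [mk_cons, mul_assoc] at h
      exact ih (σ_mul_left_cancel h)

instance : IsRightCancelMul Pos where
  mul_right_cancel x y z h := by
    obtain ⟨u, rfl⟩ := mk_surj x
    induction u using List.reverseRecOn with
    | nil => simpa [mk_nil] using h
    | append_singleton u i ih =>
      simp only [mk_append, ← mul_assoc] at h
      exact ih (σ_mul_right_cancel h)

theorem σ_rels (n : ℕ) : Rels σ n where
  comm {i j} h _ := by simpa using σ_comm (Or.inl h) 1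
  braid {i} h := by simpa [mul_assoc] using σ_braid (Or.inl rfl : Adj i (i + 1)) 1

/-- The positive braid monoid on `n` generators. -/
abbrev PosN (n : ℕ) : Submonoid Pos := Submonoid.closure (σ '' Set.Iio n)

/-- The central element of the positive braid monoid on `n` generators. -/
def fullTwist (n : ℕ) : PosN n := ⟨asc σ n ^ (n + 1), pow_mem (asc_mem fun _ h => h) _⟩

theorem fullTwist_comm (n : ℕ) (x : PosN n) : fullTwist n * x = x * fullTwist n := by
  obtain ⟨x, hx⟩ := x
  refine Subtype.ext ?_
  change asc σ n ^ (n + 1) * x = x * asc σ n ^ (n + 1)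
  induction hx using Submonoid.closure_induction with
  | mem x hx => obtain ⟨i, hi, rfl⟩ := hx; exact (σ_rels n).asc_pow_central hi
  | one => simp
  | mul x y _ _ hx hy => rw [← mul_assoc, hx, mul_assoc, hy, mul_assoc]

theorem fullTwist_pow_comm (n : ℕ) (t : Submonoid.powers (fullTwist n)) (x : PosN n) :
    (t : PosN n) * x = x * t := by
  obtain ⟨_, k, rfl⟩ := t
  have h : Commute (fullTwist n) x := fullTwist_comm n x
  exact h.pow_left k

instance (n : ℕ) : OreLocalization.OreSet (Submonoid.powers (fullTwist n)) where
  ore_right_cancel r₁ r₂ s h := ⟨1, by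
    have := congrArg Subtype.val h
    rw [Subtype.ext (mul_right_cancel this)]⟩
  oreNum r _ := r
  oreDenom _ s := s
  ore_eq r s := fullTwist_pow_comm n s r

/-- The localization of the positive braid monoid at its central element. -/
abbrev Loc (n : ℕ) := OreLocalization (Submonoid.powers (fullTwist n)) (PosN n)

/-- The map to the localization. -/
abbrev toLoc (n : ℕ) : PosN n →* Loc n := OreLocalization.numeratorHom

theorem toLoc_injective (n : ℕ) : Function.Injective (toLoc n) := by
  intro x y h
  rw [toLoc, OreLocalization.numeratorHom_apply, OreLocalization.numeratorHom_apply,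
    OreLocalization.oreDiv_eq_iff] at h
  obtain ⟨u, v, h₁, h₂⟩ := h
  simp only [Submonoid.coe_one, mul_one] at h₂
  subst h₂
  have h₃ : (u : PosN n) * y = u * x := h₁
  exact (Subtype.ext (mul_left_cancel (congrArg Subtype.val h₃))).symm

/-- The generators of the positive braid monoid on `n` generators. -/
def σN (n : ℕ) (i : Fin n) : PosN n := ⟨σ i, Submonoid.subset_closure ⟨i, i.2, rfl⟩⟩

theorem isUnit_toLoc_σN (n : ℕ) (i : Fin n) : IsUnit (toLoc n (σN n i)) := by
  obtain ⟨y, hy, h⟩ := (σ_rels n).dvd_asc_pow i.2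
  have h₁ : σN n i * ⟨y, hy⟩ = fullTwist n := Subtype.ext h.symm
  have h₂ : (⟨y, hy⟩ : PosN n) * σN n i = fullTwist n := by
    have h₃ : σN n i * (⟨y, hy⟩ * σN n i) = σN n i * fullTwist n := by
      rw [← mul_assoc, h₁, fullTwist_comm]
    exact Subtype.ext (mul_left_cancel (congrArg Subtype.val h₃))
  have hu : IsUnit (toLoc n (fullTwist n)) :=
    OreLocalization.numerator_isUnit (⟨fullTwist n, 1, pow_one _⟩ :
      Submonoid.powers (fullTwist n))
  have e₁ : IsUnit (toLoc n (σN n i) * toLoc n ⟨y, hy⟩) := by rw [← map_mul, h₁]; exact hu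
  have e₂ : IsUnit (toLoc n ⟨y, hy⟩ * toLoc n (σN n i)) := by rw [← map_mul, h₂]; exact hu
  obtain ⟨a, ha⟩ := e₁
  obtain ⟨b, hb⟩ := e₂
  have l : ↑b⁻¹ * toLoc n ⟨y, hy⟩ * toLoc n (σN n i) = 1 := by rw [mul_assoc, ← hb]; simp
  have r : toLoc n (σN n i) * (toLoc n ⟨y, hy⟩ * ↑a⁻¹) = 1 := by rw [← mul_assoc, ← ha]; simp
  refine isUnit_iff_exists.2 ⟨_, r, ?_⟩
  rw [← left_inv_eq_right_inv l r, l]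

end BraidWord

/-! ### Groups with a well-behaved positive monoid satisfying the braid relations -/

namespace BraidWord

theorem Far.ne {i j : ℕ} (h : Far i j) : i ≠ j := by unfold Far at h; omega

theorem Adj.ne {i j : ℕ} (h : Adj i j) : i ≠ j := by unfold Adj at h; omega

theorem Far.not_adj {i j : ℕ} (h : Far i j) : ¬ Adj i j := by unfold Far at h; unfold Adj; omega

section

variable {Γ : Type*} [Group Γ]

/-- The submonoid generated by the `s i` with `i ∈ A`. -/
abbrev Mon (s : ℕ → Γ) (A : Set ℕ) : Submonoid Γ := Submonoid.closure (Set.image s A)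

/-- The subgroup generated by the `s i` with `i ∈ A`. -/
abbrev Grp (s : ℕ → Γ) (A : Set ℕ) : Subgroup Γ := Subgroup.closure (Set.image s A)

/-- The properties of the embedding of the positive braid monoid on `n` generators in the
braid group that are used below. -/
structure BraidLike (s : ℕ → Γ) (n : ℕ) : Prop extends Rels s n where
  exists_len : ∃ f : Γ →* Multiplicative ℤ, ∀ i < n, f (s i) = Multiplicative.ofAdd 1
  supp : ∀ {A : Set ℕ} {x y : Γ}, A ⊆ Set.Iio n → x ∈ Mon s (Set.Iio n) →
    y ∈ Mon s (Set.Iio n) → x * y ∈ Mon s A → x ∈ Mon s A ∧ y ∈ Mon s A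
  lcm_right : ∀ {i j : ℕ} {x y : Γ}, i < n → j < n → x ∈ Mon s (Set.Iio n) →
    y ∈ Mon s (Set.Iio n) → x * s i = y * s j → i = j ∨
      (Far i j ∧ ∃ z ∈ Mon s (Set.Iio n), x = z * s j ∧ y = z * s i) ∨
      (Adj i j ∧ ∃ z ∈ Mon s (Set.Iio n), x = z * s i * s j ∧ y = z * s j * s i)
  lcm_left : ∀ {i j : ℕ} {x y : Γ}, i < n → j < n → x ∈ Mon s (Set.Iio n) →
    y ∈ Mon s (Set.Iio n) → s i * x = s j * y → i = j ∨
      (Far i j ∧ ∃ z ∈ Mon s (Set.Iio n), x = s j * z ∧ y = s i * z) ∨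
      (Adj i j ∧ ∃ z ∈ Mon s (Set.Iio n), x = s j * (s i * z) ∧ y = s i * (s j * z))

theorem Mon.mono (s : ℕ → Γ) {A B : Set ℕ} (h : A ⊆ B) : Mon s A ≤ Mon s B :=
  Submonoid.closure_mono (Set.image_mono h)

theorem Grp.mono (s : ℕ → Γ) {A B : Set ℕ} (h : A ⊆ B) : Grp s A ≤ Grp s B :=
  Subgroup.closure_mono (Set.image_mono h)

theorem Mon.gen_mem (s : ℕ → Γ) {A : Set ℕ} {i : ℕ} (h : i ∈ A) : s i ∈ Mon s A :=
  Submonoid.subset_closure ⟨i, h, rfl⟩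

theorem Grp.gen_mem (s : ℕ → Γ) {A : Set ℕ} {i : ℕ} (h : i ∈ A) : s i ∈ Grp s A :=
  Subgroup.subset_closure ⟨i, h, rfl⟩

theorem Mon.le_Grp (s : ℕ → Γ) (A : Set ℕ) {x : Γ} (h : x ∈ Mon s A) : x ∈ Grp s A :=
  (Submonoid.closure_le (S := (Grp s A).toSubmonoid)).2 Subgroup.subset_closure h

theorem Mon.comp (s : ℕ → Γ) (φ : ℕ → ℕ) (A : Set ℕ) :
    Mon (fun i => s (φ i)) A = Mon s (φ '' A) := by
  rw [Mon, Mon, ← Set.image_comp]; rfl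

theorem Grp.comp (s : ℕ → Γ) (φ : ℕ → ℕ) (A : Set ℕ) :
    Grp (fun i => s (φ i)) A = Grp s (φ '' A) := by
  rw [Grp, Grp, ← Set.image_comp]; rfl

theorem Mon.mem_op {s : ℕ → Γ} {A : Set ℕ} {x : Γ} :
    MulOpposite.op x ∈ Mon (fun i => MulOpposite.op (s i)) A ↔ x ∈ Mon s A := by
  constructor
  · intro h
    have key : ∀ z ∈ Mon (fun i => MulOpposite.op (s i)) A, z.unop ∈ Mon s A := by
      intro z hz
      induction hz using Submonoid.closure_induction with
      | mem x hx => obtain ⟨i, hi, rfl⟩ := hx; exact Mon.gen_mem s hi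
      | one => exact one_mem _
      | mul x y _ _ hx hy => exact mul_mem hy hx
    exact key _ h
  · intro h
    induction h using Submonoid.closure_induction with
    | mem x hx =>
      obtain ⟨i, hi, rfl⟩ := hx
      exact Mon.gen_mem (fun i => MulOpposite.op (s i)) hi
    | one => exact one_mem _
    | mul x y _ _ hx hy => exact mul_mem hy hx

namespace BraidLike

variable {s : ℕ → Γ} {n : ℕ}

theorem comp (B : BraidLike s n) {m : ℕ} {φ : ℕ → ℕ} (hφ : ∀ i < m, φ i < n)
    (hfar : ∀ i < m, ∀ j < m, Far i j → Far (φ i) (φ j))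
    (hadj : ∀ i < m, ∀ j < m, Adj i j → Adj (φ i) (φ j)) :
    BraidLike (fun i => s (φ i)) m := by
  have himg : ∀ {A : Set ℕ}, A ⊆ Set.Iio m → φ '' A ⊆ Set.Iio n := by
    rintro A hA _ ⟨i, hi, rfl⟩
    exact hφ i (hA hi)
  have hle : ∀ {x}, x ∈ Mon (fun i => s (φ i)) (Set.Iio m) → x ∈ Mon s (Set.Iio n) := by
    intro x hx
    rw [Mon.comp] at hx
    exact Mon.mono s (himg subset_rfl) hx
  have hg : ∀ {i}, i < m → s (φ i) ∈ Mon s (Set.Iio n) := fun hi => Mon.gen_mem s (hφ _ hi)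
  have hsupp : ∀ {A : Set ℕ} {x y : Γ}, A ⊆ Set.Iio m → x ∈ Mon s (Set.Iio n) →
      y ∈ Mon s (Set.Iio n) → x * y ∈ Mon (fun i => s (φ i)) A →
      x ∈ Mon (fun i => s (φ i)) A ∧ y ∈ Mon (fun i => s (φ i)) A := by
    intro A x y hA hx hy hxy
    rw [Mon.comp] at hxy ⊢
    exact B.supp (himg hA) hx hy hxy
  refine
    { comm := fun {i j} h hj => B.comm' (hφ _ (by omega)) (hφ _ hj)
        (hfar i (by omega) j hj (Or.inl h))
      braid := fun {i} h => B.braid' (hφ _ (by omega)) (hφ _ h)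
        (hadj i (by omega) (i + 1) h (Or.inl rfl))
      exists_len := ?_
      supp := fun hA hx hy hxy => hsupp hA (hle hx) (hle hy) hxy
      lcm_right := ?_
      lcm_left := ?_ }
  · obtain ⟨f, hf⟩ := B.exists_len
    exact ⟨f, fun i hi => hf _ (hφ i hi)⟩
  · intro i j x y hi hj hx hy h
    rcases far_or_adj i j with rfl | hij | hij
    · exact .inl rfl
    · have hij' := hfar i hi j hj hij
      rcases B.lcm_right (hφ i hi) (hφ j hj) (hle hx) (hle hy) h with h | ⟨-, z, hz, h₁, h₂⟩ | h
      · exact absurd h hij'.ne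
      · rw [h₁] at hx
        exact .inr (.inl ⟨hij, z, (hsupp subset_rfl hz (hg hj) hx).1, h₁, h₂⟩)
      · exact absurd h.1 hij'.not_adj
    · have hij' := hadj i hi j hj hij
      rcases B.lcm_right (hφ i hi) (hφ j hj) (hle hx) (hle hy) h with h | h | ⟨-, z, hz, h₁, h₂⟩
      · exact absurd h hij'.ne
      · exact absurd hij' h.1.not_adj
      · rw [h₁, mul_assoc] at hx
        exact .inr (.inr ⟨hij, z, (hsupp subset_rfl hz (mul_mem (hg hi) (hg hj)) hx).1, h₁, h₂⟩)
  · intro i j x y hi hj hx hy h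
    rcases far_or_adj i j with rfl | hij | hij
    · exact .inl rfl
    · have hij' := hfar i hi j hj hij
      rcases B.lcm_left (hφ i hi) (hφ j hj) (hle hx) (hle hy) h with h | ⟨-, z, hz, h₁, h₂⟩ | h
      · exact absurd h hij'.ne
      · rw [h₁] at hx
        exact .inr (.inl ⟨hij, z, (hsupp subset_rfl (hg hj) hz hx).2, h₁, h₂⟩)
      · exact absurd h.1 hij'.not_adj
    · have hij' := hadj i hi j hj hij
      rcases B.lcm_left (hφ i hi) (hφ j hj) (hle hx) (hle hy) h with h | h | ⟨-, z, hz, h₁, h₂⟩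
      · exact absurd h hij'.ne
      · exact absurd hij' h.1.not_adj
      · rw [h₁, ← mul_assoc] at hx
        exact .inr (.inr ⟨hij, z, (hsupp subset_rfl (mul_mem (hg hj) (hg hi)) hz hx).2, h₁, h₂⟩)

theorem shift (B : BraidLike s n) (p : ℕ) : BraidLike (fun i => s (p + i)) (n - p) :=
  B.comp (fun i hi => by omega) (fun i _ j _ h => by unfold Far at *; omega)
    (fun i _ j _ h => by unfold Adj at *; omega)

theorem flip (B : BraidLike s n) : BraidLike (fun i => s (n - 1 - i)) n :=
  B.comp (fun i hi => by omega) (fun i _ j _ h => by unfold Far at *; omega)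
    (fun i _ j _ h => by unfold Adj at *; omega)

theorem op (B : BraidLike s n) : BraidLike (fun i => MulOpposite.op (s i)) n where
  comm h hj := by
    rw [← MulOpposite.op_mul, ← MulOpposite.op_mul, B.comm h hj]
  braid h := by
    simp only [← MulOpposite.op_mul]
    rw [← mul_assoc, B.braid h, mul_assoc]
  exists_len := by
    obtain ⟨f, hf⟩ := B.exists_len
    refine ⟨⟨⟨fun x => f x.unop, by simp⟩, fun x y => by simp [mul_comm]⟩, fun i hi => hf i hi⟩
  supp {A x y} hA hx hy hxy := by
    induction x using MulOpposite.rec' with | _ x => ?_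
    induction y using MulOpposite.rec' with | _ y => ?_
    rw [← MulOpposite.op_mul, Mon.mem_op] at hxy
    rw [Mon.mem_op] at hx hy
    rw [Mon.mem_op, Mon.mem_op]
    exact (B.supp hA hy hx hxy).symm
  lcm_right {i j x y} hi hj hx hy h := by
    induction x using MulOpposite.rec' with | _ x => ?_
    induction y using MulOpposite.rec' with | _ y => ?_
    rw [Mon.mem_op] at hx hy
    rcases B.lcm_left hi hj hx hy (congrArg MulOpposite.unop h) with
      h | ⟨hij, z, hz, rfl, rfl⟩ | ⟨hij, z, hz, rfl, rfl⟩
    · exact .inl h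
    · exact .inr (.inl ⟨hij, MulOpposite.op z, Mon.mem_op.2 hz, rfl, rfl⟩)
    · exact .inr (.inr ⟨hij, MulOpposite.op z, Mon.mem_op.2 hz, rfl, rfl⟩)
  lcm_left {i j x y} hi hj hx hy h := by
    induction x using MulOpposite.rec' with | _ x => ?_
    induction y using MulOpposite.rec' with | _ y => ?_
    rw [Mon.mem_op] at hx hy
    rcases B.lcm_right hi hj hx hy (congrArg MulOpposite.unop h) with
      h | ⟨hij, z, hz, rfl, rfl⟩ | ⟨hij, z, hz, rfl, rfl⟩
    · exact .inl h
    · exact .inr (.inl ⟨hij, MulOpposite.op z, Mon.mem_op.2 hz, rfl, rfl⟩)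
    · exact .inr (.inr ⟨hij, MulOpposite.op z, Mon.mem_op.2 hz, rfl, rfl⟩)

end BraidLike

end

/-! ### The braid group is an instance -/

open BraidOrder

theorem gen_of_lt {n i : ℕ} (h : i < n) : gen n i = PresentedGroup.of ⟨i, h⟩ := dif_pos h

theorem gen_rels (n : ℕ) : Rels (gen n) n where
  comm {i j} h hj := by
    rw [gen_of_lt hj, gen_of_lt (show i < n by omega), ← mul_inv_eq_one]
    exact PresentedGroup.one_of_mem (rels := braidRel n)
      ⟨⟨i, by omega⟩, ⟨j, hj⟩, .inr ⟨h, rfl⟩⟩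
  braid {i} h := by
    rw [gen_of_lt h, gen_of_lt (show i < n by omega), ← mul_inv_eq_one]
    exact PresentedGroup.one_of_mem (rels := braidRel n)
      ⟨⟨i, by omega⟩, ⟨i + 1, h⟩, .inl ⟨rfl, rfl⟩⟩

/-- A sequence satisfying the braid relations defines a homomorphism from the braid group. -/
def braidLift {H : Type*} [Group H] {n : ℕ} (f : Fin n → H)
    (comm : ∀ i j : Fin n, (i : ℕ) + 2 ≤ j → f i * f j = f j * f i)
    (braid : ∀ i j : Fin n, (i : ℕ) + 1 = j → f i * f j * f i = f j * f i * f j) :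
    Braid n →* H :=
  PresentedGroup.toGroup (f := f) (by
    rintro _ ⟨i, j, ⟨h, rfl⟩ | ⟨h, rfl⟩⟩
    · simp only [map_mul, map_inv, FreeGroup.lift_apply_of]
      rw [braid i j h, mul_inv_cancel]
    · simp only [map_mul, map_inv, FreeGroup.lift_apply_of]
      rw [comm i j h, mul_inv_cancel])

theorem braidLift_gen {H : Type*} [Group H] {n : ℕ} {f : Fin n → H}
    (comm : ∀ i j : Fin n, (i : ℕ) + 2 ≤ j → f i * f j = f j * f i)
    (braid : ∀ i j : Fin n, (i : ℕ) + 1 = j → f i * f j * f i = f j * f i * f j)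
    {i : ℕ} (h : i < n) : braidLift f comm braid (gen n i) = f ⟨i, h⟩ := by
  rw [gen_of_lt h]
  exact PresentedGroup.toGroup.of _

/-- The homomorphism from the braid group to the units of the localization. -/
noncomputable def toUnits (n : ℕ) : Braid n →* (Loc n)ˣ :=
  braidLift (fun i => (isUnit_toLoc_σN n i).unit)
    (fun i j h => Units.ext (by
      simp only [Units.val_mul, IsUnit.unit_spec, ← map_mul]
      exact congrArg _ (Subtype.ext ((σ_rels n).comm h j.2))))
    (fun i j h => Units.ext (by
      simp only [Units.val_mul, IsUnit.unit_spec, ← map_mul]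
      exact congrArg _ (Subtype.ext ((σ_rels n).braid' i.2 j.2 (Or.inl h)))))

/-- The braid represented by a positive word. -/
def wd (n : ℕ) (u : List ℕ) : Braid n := (u.map (gen n)).prod

theorem wd_append (n : ℕ) (u v : List ℕ) : wd n (u ++ v) = wd n u * wd n v := by simp [wd]

theorem wd_of_bEq {n : ℕ} {u v : List ℕ} (h : BEq u v) (hu : ∀ i ∈ u, i < n) :
    wd n u = wd n v := by
  induction h with
  | refl => rfl
  | symm h ih => exact (ih fun i hi => hu i ((h.mem_iff i).1 hi)).symm
  | trans h₁ _ ih₁ ih₂ => exact (ih₁ hu).trans (ih₂ fun i hi => hu i ((h₁.mem_iff i).2 hi))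
  | cons i _ ih =>
    rw [wd, wd, List.map_cons, List.map_cons, List.prod_cons, List.prod_cons]
    exact congrArg _ (ih fun j hj => hu j (List.mem_cons_of_mem _ hj))
  | @comm i j u h =>
    simp only [wd, List.map_cons, List.prod_cons, ← mul_assoc]
    rw [(gen_rels n).comm' (hu i (by simp)) (hu j (by simp)) h]
  | @braid i j u h =>
    simp only [wd, List.map_cons, List.prod_cons, ← mul_assoc]
    rw [(gen_rels n).braid' (hu i (by simp)) (hu j (by simp)) h]

theorem mk_mem {n : ℕ} {u : List ℕ} (hu : ∀ i ∈ u, i < n) : mk u ∈ PosN n := by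
  induction u with
  | nil => exact one_mem _
  | cons i u ih =>
    have hi : σ i ∈ PosN n := Submonoid.subset_closure ⟨i, hu i (by simp), rfl⟩
    exact (PosN n).mul_mem hi (ih fun j hj => hu j (List.mem_cons_of_mem _ hj))

theorem toUnits_wd {n : ℕ} {u : List ℕ} (hu : ∀ i ∈ u, i < n) :
    (toUnits n (wd n u) : Loc n) = toLoc n ⟨mk u, mk_mem hu⟩ := by
  induction u with
  | nil => exact (congrArg Units.val (map_one (toUnits n))).trans (map_one (toLoc n)).symm
  | cons i u ih =>
    have hi : i < n := hu i (by simp)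
    have hu' : ∀ j ∈ u, j < n := fun j hj => hu j (List.mem_cons_of_mem _ hj)
    have e : (⟨mk (i :: u), mk_mem hu⟩ : PosN n) = σN n ⟨i, hi⟩ * ⟨mk u, mk_mem hu'⟩ := rfl
    have e' : wd n (i :: u) = gen n i * wd n u := by simp [wd]
    rw [e, e', map_mul, map_mul, Units.val_mul, ih hu', toUnits, braidLift_gen _ _ hi]
    rfl

theorem bEq_of_wd {n : ℕ} {u v : List ℕ} (hu : ∀ i ∈ u, i < n) (hv : ∀ i ∈ v, i < n)
    (h : wd n u = wd n v) : BEq u v := by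
  have h' := toUnits_wd hu
  rw [h, toUnits_wd hv] at h'
  exact (mk_eq.1 (congrArg Subtype.val (toLoc_injective n h'))).symm

theorem mem_mon_gen {n : ℕ} {A : Set ℕ} {x : Braid n} :
    x ∈ Mon (gen n) A ↔ ∃ u : List ℕ, (∀ i ∈ u, i ∈ A) ∧ wd n u = x := by
  constructor
  · intro h
    induction h using Submonoid.closure_induction with
    | mem x hx => obtain ⟨i, hi, rfl⟩ := hx; exact ⟨[i], by simpa using hi, by simp [wd]⟩
    | one => exact ⟨[], by simp, by simp [wd]⟩
    | mul x y _ _ hx hy =>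
      obtain ⟨u, hu, rfl⟩ := hx
      obtain ⟨v, hv, rfl⟩ := hy
      refine ⟨u ++ v, fun i hi => ?_, wd_append n u v⟩
      rcases List.mem_append.1 hi with hi | hi
      exacts [hu i hi, hv i hi]
  · rintro ⟨u, hu, rfl⟩
    refine list_prod_mem fun x hx => ?_
    obtain ⟨i, hi, rfl⟩ := List.mem_map.1 hx
    exact Mon.gen_mem _ (hu i hi)

theorem braidLike_gen (n : ℕ) : BraidLike (gen n) n where
  toRels := gen_rels n
  exists_len := ⟨braidLift (fun _ => Multiplicative.ofAdd 1) (fun _ _ _ => rfl) (fun _ _ _ => rfl),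
    fun i hi => braidLift_gen _ _ hi⟩
  supp {A x y} hA hx hy hxy := by
    obtain ⟨u, hu, rfl⟩ := mem_mon_gen.1 hx
    obtain ⟨v, hv, rfl⟩ := mem_mon_gen.1 hy
    obtain ⟨w, hw, h⟩ := mem_mon_gen.1 hxy
    rw [← wd_append] at h
    have h' := bEq_of_wd (fun i hi => hA (hw i hi))
      (fun i hi => (List.mem_append.1 hi).elim (hu i) (hv i)) h
    exact ⟨mem_mon_gen.2 ⟨u, fun i hi => hw i ((h'.mem_iff i).2 (List.mem_append_left _ hi)), rfl⟩,
      mem_mon_gen.2 ⟨v, fun i hi => hw i ((h'.mem_iff i).2 (List.mem_append_right _ hi)), rfl⟩⟩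
  lcm_right {i j x y} hi hj hx hy h := by
    obtain ⟨u, hu, rfl⟩ := mem_mon_gen.1 hx
    obtain ⟨v, hv, rfl⟩ := mem_mon_gen.1 hy
    have h' : wd n (u ++ [i]) = wd n (v ++ [j]) := by simpa [wd] using h
    have hbeq := bEq_of_wd (fun k hk => (List.mem_append.1 hk).elim (hu k) (by simp; omega))
      (fun k hk => (List.mem_append.1 hk).elim (hv k) (by simp; omega)) h'
    rcases hbeq.lcm_right with h | ⟨h, w, h₁, h₂⟩ | ⟨h, w, h₁, h₂⟩
    · exact .inl h.1
    · refine .inr (.inl ⟨h, wd n w, mem_mon_gen.2 ⟨w, fun k hk => hu k ((h₁.mem_iff k).2 ?_), rfl⟩,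
        ?_, ?_⟩)
      · exact List.mem_append_left _ hk
      · simpa [wd] using wd_of_bEq h₁ hu
      · simpa [wd] using wd_of_bEq h₂ hv
    · refine .inr (.inr ⟨h, wd n w, mem_mon_gen.2 ⟨w, fun k hk => hu k ((h₁.mem_iff k).2 ?_), rfl⟩,
        ?_, ?_⟩)
      · exact List.mem_append_left _ hk
      · simpa [wd, mul_assoc] using wd_of_bEq h₁ hu
      · simpa [wd, mul_assoc] using wd_of_bEq h₂ hv
  lcm_left {i j x y} hi hj hx hy h := by
    obtain ⟨u, hu, rfl⟩ := mem_mon_gen.1 hx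
    obtain ⟨v, hv, rfl⟩ := mem_mon_gen.1 hy
    have h' : wd n (i :: u) = wd n (j :: v) := by simpa [wd] using h
    have hbeq := bEq_of_wd (fun k hk => (List.mem_cons.1 hk).elim (by omega) (hu k))
      (fun k hk => (List.mem_cons.1 hk).elim (by omega) (hv k)) h'
    rcases hbeq.lcm_left with h | ⟨h, w, h₁, h₂⟩ | ⟨h, w, h₁, h₂⟩
    · exact .inl h.1
    · refine .inr (.inl ⟨h, wd n w, mem_mon_gen.2 ⟨w, fun k hk => hu k ((h₁.mem_iff k).2 ?_), rfl⟩,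
        ?_, ?_⟩)
      · exact List.mem_cons_of_mem _ hk
      · simpa [wd] using wd_of_bEq h₁ hu
      · simpa [wd] using wd_of_bEq h₂ hv
    · refine .inr (.inr ⟨h, wd n w, mem_mon_gen.2 ⟨w, fun k hk => hu k ((h₁.mem_iff k).2 ?_), rfl⟩,
        ?_, ?_⟩)
      · exact List.mem_cons_of_mem _ (List.mem_cons_of_mem _ hk)
      · simpa [wd] using wd_of_bEq h₁ hu
      · simpa [wd] using wd_of_bEq h₂ hv

end BraidWord

/-! ### Divisibility by generators -/

namespace BraidWord

variable {Γ : Type*} [Group Γ] {s : ℕ → Γ} {n : ℕ}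

theorem Mon.cases_right {A : Set ℕ} {x : Γ} (h : x ∈ Mon s A) :
    x = 1 ∨ ∃ y ∈ Mon s A, ∃ i ∈ A, x = y * s i := by
  induction h using Submonoid.closure_induction_right with
  | one => exact .inl rfl
  | mul_right x hx y hy _ => obtain ⟨i, hi, rfl⟩ := hy; exact .inr ⟨x, hx, i, hi, rfl⟩

@[elab_as_elim]
theorem Mon.induction_left {A : Set ℕ} {p : (x : Γ) → x ∈ Mon s A → Prop}
    (one : p 1 (one_mem _))
    (mul : ∀ i (hi : i ∈ A) x (hx : x ∈ Mon s A), p x hx →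
      p (s i * x) (mul_mem (Mon.gen_mem s hi) hx)) {x : Γ} (hx : x ∈ Mon s A) : p x hx := by
  induction hx using Submonoid.closure_induction_left with
  | one => exact one
  | mul_left x hx y hy ih => obtain ⟨i, hi, rfl⟩ := hx; exact mul i hi y hy ih

@[elab_as_elim]
theorem Mon.induction_right {A : Set ℕ} {p : (x : Γ) → x ∈ Mon s A → Prop}
    (one : p 1 (one_mem _))
    (mul : ∀ x (hx : x ∈ Mon s A) i (hi : i ∈ A), p x hx →
      p (x * s i) (mul_mem hx (Mon.gen_mem s hi))) {x : Γ} (hx : x ∈ Mon s A) : p x hx := by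
  induction hx using Submonoid.closure_induction_right with
  | one => exact one
  | mul_right x hx y hy ih => obtain ⟨i, hi, rfl⟩ := hy; exact mul x hx i hi ih

theorem desc_split (s : ℕ → Γ) {j m : ℕ} (h : j ≤ m) :
    ∃ w ∈ Mon s (Set.Ico j m), desc s m = w * desc s j := by
  induction m, h using Nat.le_induction with
  | base => exact ⟨1, one_mem _, (one_mul _).symm⟩
  | succ m h ih =>
    obtain ⟨w, hw, e⟩ := ih
    refine ⟨s m * w, mul_mem (Mon.gen_mem s ⟨h, by omega⟩)
      (Mon.mono s (Set.Ico_subset_Ico_right (by omega)) hw), ?_⟩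
    rw [desc, e, mul_assoc]

theorem asc_split (s : ℕ → Γ) {j m : ℕ} (h : j ≤ m) :
    ∃ w ∈ Mon s (Set.Ico j m), asc s m = asc s j * w := by
  induction m, h using Nat.le_induction with
  | base => exact ⟨1, one_mem _, (mul_one _).symm⟩
  | succ m h ih =>
    obtain ⟨w, hw, e⟩ := ih
    refine ⟨w * s m, mul_mem (Mon.mono s (Set.Ico_subset_Ico_right (by omega)) hw)
      (Mon.gen_mem s ⟨h, by omega⟩), ?_⟩
    rw [asc, e, mul_assoc]

theorem asc_flip (s : ℕ → Γ) (n : ℕ) : asc (fun i => s (n - 1 - i)) n = desc s n := by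
  induction n generalizing s with
  | zero => rfl
  | succ n ih =>
    rw [asc_succ', desc, ← ih]
    simp only [Nat.add_sub_cancel, Nat.sub_zero]
    congr 2
    ext i
    congr 1
    omega

/-- `y` is not right-divisible by a generator indexed by `A`. -/
def NoTail (s : ℕ → Γ) (n : ℕ) (A : Set ℕ) (y : Γ) : Prop :=
  ∀ i ∈ A, y * (s i)⁻¹ ∉ Mon s (Set.Iio n)

/-- `y` is what remains of `x` after removing its tail in the submonoid indexed by `A`. -/
def IsStrip (s : ℕ → Γ) (n : ℕ) (A : Set ℕ) (x y : Γ) : Prop :=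
  y ∈ Mon s (Set.Iio n) ∧ y⁻¹ * x ∈ Mon s A ∧ NoTail s n A y

/-- `x` has an alternating form of length at most `J`, ending with a factor indexed by `A`. -/
def Br (s : ℕ → Γ) (n : ℕ) : Set ℕ → Set ℕ → ℕ → Γ → Prop
  | _, _, 0, x => x = 1
  | A, A', J + 1, x => ∃ y, IsStrip s n A x y ∧ Br s n A' A J y

theorem IsStrip.mul {A : Set ℕ} {x y t : Γ} (h : IsStrip s n A x y) (ht : t ∈ Mon s A) :
    IsStrip s n A (x * t) y :=
  ⟨h.1, by rw [← mul_assoc]; exact mul_mem h.2.1 ht, h.2.2⟩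

theorem NoTail.isStrip_mul {A : Set ℕ} {y t : Γ} (hy : y ∈ Mon s (Set.Iio n))
    (h : NoTail s n A y) (ht : t ∈ Mon s A) : IsStrip s n A (y * t) y :=
  ⟨hy, by rwa [inv_mul_cancel_left], h⟩

namespace BraidLike

variable (B : BraidLike s n)

/-- The abelianization of the group, as an integer-valued length. -/
noncomputable def len (x : Γ) : ℤ := (B.exists_len.choose x).toAdd

theorem len_mul (x y : Γ) : B.len (x * y) = B.len x + B.len y := by simp [len]

theorem len_one : B.len 1 = 0 := by simp [len]

theorem len_inv (x : Γ) : B.len x⁻¹ = - B.len x := by simp [len]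

theorem len_gen {i : ℕ} (h : i < n) : B.len (s i) = 1 := by
  rw [len, B.exists_len.choose_spec i h]; rfl

theorem len_nonneg (B : BraidLike s n) {x : Γ} (h : x ∈ Mon s (Set.Iio n)) : 0 ≤ B.len x := by
  induction h using Mon.induction_right with
  | one => rw [B.len_one]
  | mul x hx i hi ih => rw [B.len_mul, B.len_gen hi]; omega

theorem eq_one_of_len (B : BraidLike s n)
    {x : Γ} (h : x ∈ Mon s (Set.Iio n)) (hl : B.len x ≤ 0) : x = 1 := by
  rcases Mon.cases_right h with h | ⟨y, hy, i, hi, rfl⟩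
  · exact h
  · have := B.len_nonneg hy
    rw [B.len_mul, B.len_gen hi] at hl
    omega

theorem eq_one_of_inv_mem (B : BraidLike s n) {x : Γ} (h : x ∈ Mon s (Set.Iio n))
    (h' : x⁻¹ ∈ Mon s (Set.Iio n)) : x = 1 := by
  have := B.len_nonneg h'
  rw [B.len_inv] at this
  exact B.eq_one_of_len h (by omega)

theorem peel (B : BraidLike s n)
    {A : Set ℕ} {j : ℕ} (hA : ∀ i ∈ A, i < n ∧ Far j i) (hj : j < n) {y e w : Γ}
    (hy : y ∈ Mon s (Set.Iio n)) (he : e ∈ Mon s (Set.Iio n)) (hw : w ∈ Mon s A)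
    (h : y * s j = e * w) : ∃ y' ∈ Mon s (Set.Iio n), y = y' * w ∧ e = y' * s j := by
  induction hw using Mon.induction_right generalizing y with
  | one => exact ⟨y, hy, by simp, by rw [h, mul_one]⟩
  | mul w hw i hi ih =>
    have hA' : A ⊆ Set.Iio n := fun k hk => (hA k hk).1
    rw [← mul_assoc] at h
    rcases B.lcm_right hj (hA i hi).1 hy (mul_mem he (Mon.mono s hA' hw)) h with
      h | ⟨-, z, hz, rfl, h₂⟩ | h
    · exact absurd h (hA i hi).2.ne
    · obtain ⟨y', hy', rfl, e'⟩ := ih hz h₂.symm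
      exact ⟨y', hy', by rw [mul_assoc], e'⟩
    · exact absurd h.1 (hA i hi).2.not_adj

theorem div_of_mul (B : BraidLike s n) {i j : ℕ} (hi : i < n) (hj : j < n) (hij : i ≠ j) {x : Γ}
    (hx : x ∈ Mon s (Set.Iio n)) (h : x * s i * (s j)⁻¹ ∈ Mon s (Set.Iio n)) :
    x * (s j)⁻¹ ∈ Mon s (Set.Iio n) := by
  rcases B.lcm_right hj hi h hx (by simp) with h | ⟨-, z, hz, -, rfl⟩ | ⟨-, z, hz, -, rfl⟩
  · exact absurd h.symm hij
  · simpa using hz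
  · simpa using mul_mem hz (Mon.gen_mem s hi)

theorem tail_gen (B : BraidLike s n) {A : Set ℕ} (hA : A ⊆ Set.Iio n) {y t : Γ} {i : ℕ}
    (hy : y ∈ Mon s (Set.Iio n)) (hno : NoTail s n A y) (ht : t ∈ Mon s A) (hi : i ∈ A)
    (h : y * t * (s i)⁻¹ ∈ Mon s (Set.Iio n)) : t * (s i)⁻¹ ∈ Mon s A := by
  have key : ∀ k : ℕ, ∀ t ∈ Mon s A, ∀ i ∈ A, B.len t ≤ k →
      y * t * (s i)⁻¹ ∈ Mon s (Set.Iio n) → t * (s i)⁻¹ ∈ Mon s A := by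
    intro k
    induction k using Nat.strong_induction_on with
    | _ k ih =>
      intro t ht i hi hl h
      rcases Mon.cases_right ht with rfl | ⟨t', ht', j, hj, rfl⟩
      · rw [mul_one] at h
        exact absurd h (hno i hi)
      · rw [B.len_mul, B.len_gen (hA hj)] at hl
        have hl' := B.len_nonneg (Mon.mono s hA ht')
        have hyt := mul_mem hy (Mon.mono s hA ht')
        rcases B.lcm_right (hA hi) (hA hj) h hyt (by simp [mul_assoc]) with
          rfl | ⟨hij, z, hz, h₁, h₂⟩ | ⟨hij, z, hz, h₁, h₂⟩
        · simpa using ht'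
        · have := ih (k - 1) (by omega) t' ht' i hi (by omega) (by rw [h₂]; simpa using hz)
          have e : t' * s j * (s i)⁻¹ = t' * (s i)⁻¹ * s j := by
            rw [mul_inv_eq_iff_eq_mul, mul_assoc, mul_assoc, ← B.comm' (hA hi) (hA hj) hij]
            simp
          rw [e]
          exact mul_mem this (Mon.gen_mem s hj)
        · have h₃ := ih (k - 1) (by omega) t' ht' i hi (by omega)
            (by rw [h₂]; simpa using mul_mem hz (Mon.gen_mem s (hA hj)))
          have h₄ := ih (k - 1) (by omega) _ h₃ j hj
            (by rw [B.len_mul, B.len_inv, B.len_gen (hA hi)]; omega)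
            (by rw [← mul_assoc, h₂]; simpa using hz)
          have e : t' * s j * (s i)⁻¹ = t' * (s i)⁻¹ * (s j)⁻¹ * (s i * s j) := by
            have := B.braid' (hA hi) (hA hj) hij
            rw [mul_inv_eq_iff_eq_mul, mul_assoc, this]
            simp [mul_assoc]
          rw [e]
          exact mul_mem h₄ (mul_mem (Mon.gen_mem s hi) (Mon.gen_mem s hj))
  exact key (B.len t).toNat t ht i hi (by omega) h

theorem tail_mon (B : BraidLike s n) {A : Set ℕ} (hA : A ⊆ Set.Iio n) {y t c : Γ}
    (hy : y ∈ Mon s (Set.Iio n)) (hno : NoTail s n A y) (ht : t ∈ Mon s A) (hc : c ∈ Mon s A)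
    (h : y * t * c⁻¹ ∈ Mon s (Set.Iio n)) : t * c⁻¹ ∈ Mon s A := by
  induction hc using Mon.induction_right generalizing t with
  | one => simpa using ht
  | mul c hc i hi ih =>
    rw [mul_inv_rev, ← mul_assoc] at h ⊢
    have h₁ : y * t * (s i)⁻¹ ∈ Mon s (Set.Iio n) := by
      simpa using mul_mem h (Mon.mono s hA hc)
    exact ih (B.tail_gen hA hy hno ht hi h₁) (by rwa [← mul_assoc])

theorem isStrip_unique (B : BraidLike s n) {A : Set ℕ} (hA : A ⊆ Set.Iio n) {x y y' : Γ}
    (h : IsStrip s n A x y) (h' : IsStrip s n A x y') : y = y' := by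
  obtain ⟨hy, ht, hno⟩ := h
  obtain ⟨hy', ht', hno'⟩ := h'
  have h₁ := B.tail_mon hA hy hno ht ht' (by simpa using hy')
  have h₂ := B.tail_mon hA hy' hno' ht' ht (by simpa using hy)
  have := B.eq_one_of_inv_mem (Mon.mono s hA h₁) (Mon.mono s hA (by simpa using h₂))
  simpa [inv_mul_eq_one, eq_comm] using this

theorem exists_isStrip (B : BraidLike s n) {A : Set ℕ} (hA : A ⊆ Set.Iio n) {x : Γ}
    (hx : x ∈ Mon s (Set.Iio n)) : ∃ y, IsStrip s n A x y := by
  have key : ∀ k : ℕ, ∀ x ∈ Mon s (Set.Iio n), B.len x ≤ k → ∃ y, IsStrip s n A x y := by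
    intro k
    induction k using Nat.strong_induction_on with
    | _ k ih =>
      intro x hx hl
      by_cases hno : NoTail s n A x
      · exact ⟨x, hx, by simp, hno⟩
      · unfold NoTail at hno
        push Not at hno
        obtain ⟨i, hi, h⟩ := hno
        have h₁ := B.len_nonneg h
        rw [B.len_mul, B.len_inv, B.len_gen (hA hi)] at h₁
        obtain ⟨y, hy⟩ := ih (k - 1) (by omega) _ h
          (by rw [B.len_mul, B.len_inv, B.len_gen (hA hi)]; omega)
        exact ⟨y, by simpa using hy.mul (Mon.gen_mem s hi)⟩
  exact key (B.len x).toNat x hx (by omega)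

theorem IsStrip.len_le (B : BraidLike s n)
    {A : Set ℕ} (hA : A ⊆ Set.Iio n) {x y : Γ} (h : IsStrip s n A x y) :
    B.len y ≤ B.len x := by
  have := B.len_nonneg (Mon.mono s hA h.2.1)
  rw [B.len_mul, B.len_inv] at this
  omega

/-! #### Compatibility with the tails and depths of the statement -/

open GarsideOrder

theorem tail_eq (B : BraidLike s n)
    {A : Set ℕ} (hA : A ⊆ Set.Iio n) {x y : Γ} (h : IsStrip s n A x y) :
    tail (Mon s (Set.Iio n)) (Mon s A) x = y⁻¹ * x := by
  obtain ⟨hy, ht, hno⟩ := h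
  have hex : ∃ b : Γ, b ∈ Mon s A ∧ {c : Γ | c ∈ Mon s A ∧ leR (Mon s (Set.Iio n)) c x} =
      {c : Γ | c ∈ Mon s A ∧ leR (Mon s (Set.Iio n)) c b} := by
    refine ⟨y⁻¹ * x, ht, ?_⟩
    ext c
    refine and_congr_right fun hc => ⟨fun h => ?_, fun h => ?_⟩
    · exact Mon.mono s hA (B.tail_mon hA hy hno ht hc (by simpa [leR] using h))
    · have := mul_mem hy h
      simpa [leR, mul_assoc] using this
  rw [tail, dif_pos hex]
  obtain ⟨hb, he⟩ := hex.choose_spec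
  set b := hex.choose
  have h₁ : b ∈ {c : Γ | c ∈ Mon s A ∧ leR (Mon s (Set.Iio n)) c x} := by
    rw [he]; exact ⟨hb, by simp [leR, one_mem]⟩
  have h₂ : y⁻¹ * x ∈ {c : Γ | c ∈ Mon s A ∧ leR (Mon s (Set.Iio n)) c b} := by
    rw [← he]; exact ⟨ht, by simpa [leR] using hy⟩
  have h₃ : y⁻¹ * x * b⁻¹ ∈ Mon s A := B.tail_mon hA hy hno ht hb (by simpa [leR] using h₁.2)
  have h₄ := B.eq_one_of_inv_mem (Mon.mono s hA h₃) (by simpa [leR, mul_assoc] using h₂.2)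
  exact (mul_inv_eq_one.1 h₄).symm

theorem strip_one (B : BraidLike s n)
    {A A' : Set ℕ} (hA : A ⊆ Set.Iio n) {x y : Γ} (h : IsStrip s n A x y) :
    strip (Mon s (Set.Iio n)) (Mon s A) (Mon s A') 1 x = y := by
  simp [strip, B.tail_eq hA h]

theorem strip_succ_left (M M₁ N : Submonoid Γ) (J : ℕ) (x : Γ) :
    strip M M₁ N (J + 1) x = strip M N M₁ J (strip M M₁ N 1 x) := by
  induction J with
  | zero => rfl
  | succ J ih =>
    change strip M M₁ N (J + 1) x *
        (tail M (if (J + 1) % 2 = 0 then M₁ else N) (strip M M₁ N (J + 1) x))⁻¹ =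
      strip M N M₁ J (strip M M₁ N 1 x) *
        (tail M (if J % 2 = 0 then N else M₁) (strip M N M₁ J (strip M M₁ N 1 x)))⁻¹
    rw [ih]
    rcases Nat.mod_two_eq_zero_or_one J with h | h
    · rw [if_neg (by omega), if_pos h]
    · rw [if_pos (by omega), if_neg (by omega)]

theorem strip_eq_one_iff (B : BraidLike s n)
    {A A' : Set ℕ} (hA : A ⊆ Set.Iio n) (hA' : A' ⊆ Set.Iio n) (J : ℕ)
    {x : Γ} (hx : x ∈ Mon s (Set.Iio n)) :
    strip (Mon s (Set.Iio n)) (Mon s A) (Mon s A') J x = 1 ↔ Br s n A A' J x := by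
  induction J generalizing A A' x with
  | zero => exact Iff.rfl
  | succ J ih =>
    obtain ⟨y, hy⟩ := B.exists_isStrip hA hx
    rw [strip_succ_left, B.strip_one hA hy, ih hA' hA hy.1]
    refine ⟨fun h => ⟨y, hy, h⟩, ?_⟩
    rintro ⟨z, hz, h⟩
    rwa [B.isStrip_unique hA hy hz]

/-! #### Division by descending products -/

theorem desc_dvd (B : BraidLike s n)
    {m j : ℕ} (hm : m ≤ n) (hj : 1 ≤ j) (hjn : j < n) (hjm : j ≠ m) {y e : Γ}
    (hy : y ∈ Mon s (Set.Iio n)) (he : e ∈ Mon s (Set.Iio n)) (h : y * s j = e * desc s m) :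
    ∃ y' ∈ Mon s (Set.Iio n), y = y' * desc s m := by
  rcases Nat.lt_or_ge m j with hlt | hge
  · obtain ⟨y', hy', h, -⟩ := B.peel (A := Set.Iio m)
      (fun i hi => ⟨lt_of_lt_of_le hi hm, by have : i < m := hi; unfold Far; omega⟩) hjn hy he
      (desc_mem fun _ h => h) h
    exact ⟨y', hy', h⟩
  · obtain ⟨j, rfl⟩ : ∃ i, j = i + 1 := ⟨j - 1, by omega⟩
    obtain ⟨w, hw, hd⟩ := desc_split s (show j + 2 ≤ m by omega)
    have hw' : w ∈ Mon s (Set.Iio n) := Mon.mono s (fun i hi => lt_of_lt_of_le hi.2 hm) hw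
    simp only [desc] at hd
    rw [hd] at h ⊢
    have g₀ : s j ∈ Mon s (Set.Iio n) := Mon.gen_mem s (show j < n by omega)
    have g₁ : s (j + 1) ∈ Mon s (Set.Iio n) := Mon.gen_mem s hjn
    obtain ⟨y', hy', rfl, h₁⟩ := B.peel (A := Set.Iio j) (e := e * w * s (j + 1) * s j)
      (fun i hi => by have : i < j := hi; exact ⟨by omega, by unfold Far; omega⟩) hjn hy
      (mul_mem (mul_mem (mul_mem he hw') g₁) g₀)
      (desc_mem fun _ h => h) (by rw [h]; simp only [mul_assoc])
    rcases B.lcm_right hjn (show j < n by omega) hy' (mul_mem (mul_mem he hw') g₁) h₁.symm with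
      h | ⟨h, -⟩ | ⟨-, z, hz, rfl, h₂⟩
    · omega
    · unfold Far at h; omega
    · have h₃ : z * s j = e * w := mul_right_cancel h₂.symm
      obtain ⟨z', hz', rfl, -⟩ := B.peel (A := Set.Ico (j + 2) m)
        (fun i hi => ⟨lt_of_lt_of_le hi.2 hm, by have := hi.1; unfold Far; omega⟩)
        (by omega) hz he hw h₃
      exact ⟨z', hz', by simp only [mul_assoc]⟩

theorem desc_succ_dvd (B : BraidLike s n) {m : ℕ} (hm : 1 ≤ m) (hmn : m < n) {y e : Γ}
    (hy : y ∈ Mon s (Set.Iio n)) (he : e ∈ Mon s (Set.Iio n)) (h : y * s m = e * desc s m) :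
    ∃ y' ∈ Mon s (Set.Iio n), y = y' * desc s (m + 1) := by
  obtain ⟨m, rfl⟩ : ∃ i, m = i + 1 := ⟨m - 1, by omega⟩
  have g₀ : s m ∈ Mon s (Set.Iio n) := Mon.gen_mem s (show m < n by omega)
  rw [desc, ← mul_assoc] at h
  obtain ⟨y', hy', rfl, h₁⟩ := B.peel (A := Set.Iio m)
    (fun i hi => by have : i < m := hi; exact ⟨by omega, by unfold Far; omega⟩) hmn hy
    (mul_mem he g₀) (desc_mem fun _ h => h) h
  rcases B.lcm_right hmn (show m < n by omega) hy' he h₁.symm with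
    h | ⟨h, -⟩ | ⟨-, z, hz, rfl, h₂⟩
  · omega
  · unfold Far at h; omega
  · exact ⟨z, hz, by simp only [desc, mul_assoc]⟩

theorem desc_mul_mem (B : BraidLike s n) {t : Γ} (ht : t ∈ Mon s (Set.Ico 1 n)) :
    ∃ τ ∈ Mon s (Set.Iio (n - 1)), desc s n * t = τ * desc s n := by
  induction ht using Mon.induction_right with
  | one => exact ⟨1, one_mem _, by simp⟩
  | mul t ht i hi ih =>
    obtain ⟨τ, hτ, h⟩ := ih
    obtain ⟨h₁, h₂⟩ := hi
    obtain ⟨i, rfl⟩ : ∃ j, i = j + 1 := ⟨i - 1, by omega⟩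
    refine ⟨τ * s i, mul_mem hτ (Mon.gen_mem s (show i < n - 1 by omega)), ?_⟩
    rw [← mul_assoc, h, mul_assoc, ← B.mul_desc (by omega) le_rfl, mul_assoc]

theorem desc_pred_mem (s : ℕ → Γ) (hn : 1 ≤ n) :
    ∃ d ∈ Mon s (Set.Ico 1 n), desc s n = d * s 0 := by
  obtain ⟨d, hd, h⟩ := desc_split s hn
  exact ⟨d, hd, by simpa [desc] using h⟩

theorem zero_dvd_aux (B : BraidLike s n)
    {y t : Γ} (hy : y ∈ Mon s (Set.Iio n)) (ht : t ∈ Mon s (Set.Ico 1 n))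
    (hn : 1 ≤ n) (h : y * t * (s 0)⁻¹ ∈ Mon s (Set.Iio n)) :
    ∃ m, 1 ≤ m ∧ m ≤ n ∧ (∃ y' ∈ Mon s (Set.Iio n), y = y' * desc s m) ∧
      (m < n → ∃ p ∈ Mon s (Set.Iio m), ∃ q ∈ Mon s (Set.Ico 1 n),
        desc s m * t = p * q * s 0) := by
  induction ht using Mon.induction_left generalizing y with
  | one =>
    exact ⟨1, le_rfl, hn, ⟨_, h, by simp [desc]⟩, fun _ =>
      ⟨1, one_mem _, 1, one_mem _, by simp [desc]⟩⟩
  | mul j hj t ht ih =>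
    obtain ⟨hj₁, hjn⟩ := hj
    obtain ⟨m, hm, hmn, ⟨e, he, h₁⟩, h₂⟩ := ih (mul_mem hy (Mon.gen_mem s hjn))
      (by rwa [← mul_assoc] at h)
    rcases Nat.lt_trichotomy j m with hlt | rfl | hlt
    · obtain hy' := B.desc_dvd hmn hj₁ hjn hlt.ne hy he h₁
      refine ⟨m, hm, hmn, hy', fun hmn' => ?_⟩
      obtain ⟨p, hp, q, hq, h₃⟩ := h₂ hmn'
      obtain ⟨j, rfl⟩ : ∃ i, j = i + 1 := ⟨j - 1, by omega⟩
      refine ⟨s j * p, mul_mem (Mon.gen_mem s (show j < m by omega)) hp, q, hq, ?_⟩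
      rw [← mul_assoc, ← B.mul_desc hlt hmn, mul_assoc, h₃]
      simp only [mul_assoc]
    · obtain hy' := B.desc_succ_dvd hm hjn hy he h₁
      refine ⟨j + 1, by omega, hjn, hy', fun hmn' => ?_⟩
      obtain ⟨p, hp, q, hq, h₃⟩ := h₂ hjn
      obtain ⟨j, rfl⟩ : ∃ i, j = i + 1 := ⟨j - 1, by omega⟩
      refine ⟨s j * s (j + 1) * p, mul_mem (mul_mem (Mon.gen_mem s (show j < j + 2 by omega))
        (Mon.gen_mem s (show j + 1 < j + 2 by omega)))
        (Mon.mono s (Set.Iio_subset_Iio (by omega)) hp), q, hq, ?_⟩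
      rw [← mul_assoc, ← B.mul_desc (by omega) hmn'.le, desc, mul_assoc, mul_assoc, h₃]
      simp only [mul_assoc]
    · obtain hy' := B.desc_dvd hmn hj₁ hjn hlt.ne' hy he h₁
      refine ⟨m, hm, hmn, hy', fun hmn' => ?_⟩
      obtain ⟨p, hp, q, hq, h₃⟩ := h₂ hmn'
      refine ⟨p, hp, s j * q, mul_mem (Mon.gen_mem s ⟨hj₁, hjn⟩) hq, ?_⟩
      have hc : s j * p = p * s j := by
        clear h₃
        induction hp using Mon.induction_left with
        | one => simp
        | mul i hi p hp ih =>
          have hi' : i < m := hi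
          rw [← mul_assoc, ← B.comm (by omega) hjn, mul_assoc, ih, mul_assoc]
      rw [← mul_assoc, B.desc_comm hlt hjn, mul_assoc, h₃]
      simp only [← mul_assoc]
      rw [hc]

theorem zero_dvd (B : BraidLike s n)
    {y t : Γ} (hy : y ∈ Mon s (Set.Iio n)) (ht : t ∈ Mon s (Set.Ico 1 n))
    (hn : 1 ≤ n) (h : y * t * (s 0)⁻¹ ∈ Mon s (Set.Iio n)) :
    ∃ m, 1 ≤ m ∧ m ≤ n ∧ ∃ y' ∈ Mon s (Set.Iio n), y = y' * desc s m ∧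
      ∃ p ∈ Mon s (Set.Iio (n - 1)), ∃ q ∈ Mon s (Set.Ico 1 n),
        desc s m * t = p * q * s 0 := by
  obtain ⟨m, hm, hmn, ⟨y', hy', rfl⟩, h₂⟩ := B.zero_dvd_aux hy ht hn h
  refine ⟨m, hm, hmn, y', hy', rfl, ?_⟩
  rcases Nat.lt_or_ge m n with hlt | hge
  · obtain ⟨p, hp, q, hq, h₃⟩ := h₂ hlt
    exact ⟨p, Mon.mono s (Set.Iio_subset_Iio (by omega)) hp, q, hq, h₃⟩
  · obtain rfl : m = n := by omega
    obtain ⟨τ, hτ, h₁⟩ := B.desc_mul_mem ht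
    obtain ⟨d, hd, h₂⟩ := desc_pred_mem s hn
    exact ⟨τ, hτ, d, hd, by rw [h₁, h₂, mul_assoc]⟩

theorem noTail_mul_asc (B : BraidLike s n) {y : Γ} (hy : y ∈ Mon s (Set.Iio n))
    (h : NoTail s n (Set.Ico 1 n) y) : NoTail s n (Set.Iio (n - 1)) (y * asc s n) := by
  intro i hi hdiv
  have hi' : i < n - 1 := hi
  have hin : i + 1 < n := by omega
  obtain ⟨w, hw, hd⟩ := asc_split s (show i + 2 ≤ n by omega)
  simp only [asc] at hd
  have g₀ : s i ∈ Mon s (Set.Iio n) := Mon.gen_mem s (show i < n by omega)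
  have g₁ : s (i + 1) ∈ Mon s (Set.Iio n) := Mon.gen_mem s hin
  have ha : asc s i ∈ Mon s (Set.Iio n) := asc_mem fun j hj => show j < n by omega
  have h₀ := mul_mem (mul_mem hy ha) g₀
  obtain ⟨e', he', -, h₁⟩ := B.peel (A := Set.Ico (i + 2) n) (j := i)
    (e := y * asc s i * s i * s (i + 1)) (w := w)
    (fun j hj => ⟨hj.2, by have := hj.1; unfold Far; omega⟩) (by omega) hdiv
    (mul_mem h₀ g₁) hw (by rw [hd]; simp [mul_assoc])
  rcases B.lcm_right (by omega) hin he' h₀ h₁.symm with h' | ⟨h', -⟩ | ⟨-, z, hz, -, h₂⟩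
  · omega
  · unfold Far at h'; omega
  · have h₃ : z * s (i + 1) = y * asc s i := mul_right_cancel h₂.symm
    obtain ⟨y', hy', -, rfl⟩ := B.peel (A := Set.Iio i) (j := i + 1)
      (fun j hj => by have : j < i := hj; exact ⟨by omega, by unfold Far; omega⟩) hin hz hy
      (asc_mem fun _ h => h) h₃
    exact h (i + 1) ⟨by omega, hin⟩ (by simpa using hy')

end BraidLike

end BraidWord

/-! ### Alternating forms of left divisors -/

namespace BraidWord

variable {Γ : Type*} [Group Γ] {s : ℕ → Γ} {n : ℕ}

theorem image_flip_Iio (n : ℕ) : (fun i => n - 1 - i) '' Set.Iio n = Set.Iio n := by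
  ext j
  simp only [Set.mem_image, Set.mem_Iio]
  exact ⟨by rintro ⟨i, h, rfl⟩; omega, fun h => ⟨n - 1 - j, by omega, by omega⟩⟩

theorem image_flip_Ico (n : ℕ) : (fun i => n - 1 - i) '' Set.Ico 1 n = Set.Iio (n - 1) := by
  ext j
  simp only [Set.mem_image, Set.mem_Iio, Set.mem_Ico]
  exact ⟨by rintro ⟨i, h, rfl⟩; omega, fun h => ⟨n - 1 - j, by omega, by omega⟩⟩

theorem image_flip_Iio_pred (n : ℕ) :
    (fun i => n - 1 - i) '' Set.Iio (n - 1) = Set.Ico 1 n := by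
  ext j
  simp only [Set.mem_image, Set.mem_Iio, Set.mem_Ico]
  exact ⟨by rintro ⟨i, h, rfl⟩; omega, fun h => ⟨n - 1 - j, by omega, by omega⟩⟩

theorem Mon.flip (s : ℕ → Γ) (n : ℕ) :
    Mon (fun i => s (n - 1 - i)) (Set.Iio n) = Mon s (Set.Iio n) := by
  rw [Mon.comp, image_flip_Iio]

theorem noTail_flip (A : Set ℕ) (y : Γ) : NoTail (fun i => s (n - 1 - i)) n A y ↔
    NoTail s n ((fun i => n - 1 - i) '' A) y := by
  simp [NoTail, Mon.flip]

theorem isStrip_flip (A : Set ℕ) (x y : Γ) : IsStrip (fun i => s (n - 1 - i)) n A x y ↔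
    IsStrip s n ((fun i => n - 1 - i) '' A) x y := by
  rw [IsStrip, IsStrip, noTail_flip, Mon.flip, Mon.comp s (fun i => n - 1 - i) A]

theorem br_flip (A A' : Set ℕ) (J : ℕ) (x : Γ) : Br (fun i => s (n - 1 - i)) n A A' J x ↔
    Br s n ((fun i => n - 1 - i) '' A) ((fun i => n - 1 - i) '' A') J x := by
  induction J generalizing A A' x with
  | zero => exact Iff.rfl
  | succ J ih => simp only [Br, isStrip_flip, ih]

namespace BraidLike

theorem len_flip (B : BraidLike s n)
    {x : Γ} (hx : x ∈ Mon s (Set.Iio n)) : B.flip.len x = B.len x := by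
  induction hx using Mon.induction_right with
  | one => rw [B.len_one, B.flip.len_one]
  | mul x hx i hi ih =>
    have hi' : i < n := hi
    have := B.flip.len_gen (i := n - 1 - i) (by omega)
    rw [show n - 1 - (n - 1 - i) = i by omega] at this
    rw [B.len_mul, B.flip.len_mul, B.len_gen hi, ih, this]

theorem isStrip_one (B : BraidLike s n)
    {A : Set ℕ} (hA : A ⊆ Set.Iio n) {x : Γ} (hx : x ∈ Mon s A) :
    IsStrip s n A x 1 := by
  refine ⟨one_mem _, by simpa using hx, fun i hi h => ?_⟩
  have := B.len_nonneg h
  rw [B.len_mul, B.len_one, B.len_inv, B.len_gen (hA hi)] at this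
  omega

theorem br_mul_iff (B : BraidLike s n) {A A' : Set ℕ} (hA : A ⊆ Set.Iio n) {J : ℕ} {x t : Γ}
    (hx : x ∈ Mon s (Set.Iio n)) (ht : t ∈ Mon s A) :
    Br s n A A' (J + 1) (x * t) ↔ Br s n A A' (J + 1) x := by
  obtain ⟨y, hy⟩ := B.exists_isStrip hA hx
  constructor
  · rintro ⟨y', hy', h⟩
    exact ⟨y, hy, by rwa [B.isStrip_unique hA (hy.mul ht) hy']⟩
  · rintro ⟨y', hy', h⟩
    exact ⟨y', hy'.mul ht, h⟩

theorem br_iff (B : BraidLike s n) {A A' : Set ℕ} (hA : A ⊆ Set.Iio n) {J : ℕ} {x y : Γ}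
    (h : IsStrip s n A x y) : Br s n A A' (J + 1) x ↔ Br s n A' A J y := by
  constructor
  · rintro ⟨y', hy', h'⟩
    rwa [B.isStrip_unique hA h hy']
  · exact fun h' => ⟨y, h, h'⟩

theorem br_succ (B : BraidLike s n)
    {A A' : Set ℕ} (hA : A ⊆ Set.Iio n) (hA' : A' ⊆ Set.Iio n) {J : ℕ} {x : Γ}
    (h : Br s n A A' J x) : Br s n A A' (J + 1) x := by
  induction J generalizing A A' x with
  | zero =>
    obtain rfl : x = 1 := h
    exact ⟨1, B.isStrip_one hA (one_mem _), rfl⟩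
  | succ J ih =>
    obtain ⟨y, hy, h⟩ := h
    exact ⟨y, hy, ih hA' hA h⟩

theorem br_mono (B : BraidLike s n)
    {A A' : Set ℕ} (hA : A ⊆ Set.Iio n) (hA' : A' ⊆ Set.Iio n) {J J' : ℕ} {x : Γ}
    (hJ : J ≤ J') (h : Br s n A A' J x) : Br s n A A' J' x := by
  induction J', hJ using Nat.le_induction with
  | base => exact h
  | succ J' _ ih => exact B.br_succ hA hA' ih

theorem br_left_of_gen (B : BraidLike s n) {A A' : Set ℕ} {J : ℕ} {L : ℤ}
    (H : ∀ a ∈ Mon s (Set.Iio n), ∀ i < n, B.len a < L →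
      Br s n A A' J (a * s i) → Br s n A A' J a)
    {x c : Γ} (hx : x ∈ Mon s (Set.Iio n)) (hc : c ∈ Mon s (Set.Iio n))
    (hl : B.len (x * c) ≤ L) (h : Br s n A A' J (x * c)) : Br s n A A' J x := by
  induction hc using Mon.induction_right with
  | one => simpa using h
  | mul c hc i hi ih =>
    rw [← mul_assoc] at h hl
    rw [B.len_mul, B.len_gen hi] at hl
    exact ih (by omega) (H _ (mul_mem hx hc) i hi (by omega) h)

theorem br_of_mul_gen_step (B : BraidLike s n) (hn : 2 ≤ n) {L : ℤ}
    (H : ∀ J, ∀ a ∈ Mon s (Set.Iio n), ∀ i < n, B.len a < L →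
      Br s n (Set.Iio (n - 1)) (Set.Ico 1 n) J (a * s i) →
      Br s n (Set.Iio (n - 1)) (Set.Ico 1 n) J a)
    {J : ℕ} {a : Γ} {i : ℕ} (ha : a ∈ Mon s (Set.Iio n)) (hi : i < n) (hl : B.len a ≤ L)
    (h : Br s n (Set.Ico 1 n) (Set.Iio (n - 1)) J (a * s i)) :
    Br s n (Set.Ico 1 n) (Set.Iio (n - 1)) J a := by
  have h₁ : Set.Ico 1 n ⊆ Set.Iio n := fun j hj => hj.2
  have h₀ : Set.Iio (n - 1) ⊆ Set.Iio n := Set.Iio_subset_Iio (by omega)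
  rcases J with _ | J
  · have e : B.len (a * s i) = 0 := by rw [show a * s i = 1 from h, B.len_one]
    rw [B.len_mul, B.len_gen hi] at e
    have := B.len_nonneg ha
    omega
  rcases Nat.eq_zero_or_pos i with rfl | hi₁
  swap
  · exact (B.br_mul_iff h₁ ha (Mon.gen_mem s ⟨hi₁, hi⟩)).1 h
  obtain ⟨y, hy, h⟩ := h
  have hyl := IsStrip.len_le B h₁ hy
  rw [B.len_mul, B.len_gen hi] at hyl
  rcases J with _ | J
  · obtain rfl : y = 1 := h
    exact ⟨1, B.isStrip_one h₁ (B.supp h₁ ha (Mon.gen_mem s hi) (by simpa using hy.2.1)).1, rfl⟩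
  obtain ⟨m, hm, hmn, y', hy', e, p, hp, q, hq, e'⟩ :=
    B.zero_dvd hy.1 hy.2.1 (by omega) (by simpa using ha)
  obtain rfl : a = y' * p * q := by
    rw [← mul_left_inj (s 0), mul_assoc y', mul_assoc y', ← e', ← mul_assoc, ← e]
    simp
  obtain ⟨d, hd, e₂⟩ := desc_pred_mem s hm
  have hd' : d ∈ Mon s (Set.Iio n) := Mon.mono s (fun j hj => lt_of_lt_of_le hj.2 hmn) hd
  have hyp := mul_mem hy' (Mon.mono s h₀ hp)
  have hql := B.len_nonneg (Mon.mono s h₁ hq)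
  rw [e, e₂, ← mul_assoc] at h hyl
  rw [B.len_mul, B.len_gen hi] at hyl
  have hl' := B.len_mul (y' * p) q
  have k₁ := (B.br_mul_iff h₀ (mul_mem hy' hd')
    (Mon.gen_mem s (show 0 < n - 1 by omega))).1 h
  have k₂ := B.br_left_of_gen (H _) hy' hd' (by omega) k₁
  have k₃ := (B.br_mul_iff h₀ hy' hp).2 k₂
  obtain ⟨z, hz⟩ := B.exists_isStrip h₁ hyp
  refine ⟨z, hz.mul hq, B.br_left_of_gen (H _) hz.1 (Mon.mono s h₁ hz.2.1) ?_ ?_⟩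
  · rw [mul_inv_cancel_left]; omega
  · rwa [mul_inv_cancel_left]

theorem br_of_mul_gen (B : BraidLike s n)
    (hn : 2 ≤ n) (L : ℕ) : ∀ J, ∀ a ∈ Mon s (Set.Iio n), ∀ i < n, B.len a < L →
    (Br s n (Set.Ico 1 n) (Set.Iio (n - 1)) J (a * s i) →
      Br s n (Set.Ico 1 n) (Set.Iio (n - 1)) J a) ∧
    (Br s n (Set.Iio (n - 1)) (Set.Ico 1 n) J (a * s i) →
      Br s n (Set.Iio (n - 1)) (Set.Ico 1 n) J a) := by
  induction L with
  | zero =>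
    intro J a ha i hi hl
    have := B.len_nonneg ha
    omega
  | succ L ih =>
    intro J a ha i hi hl
    push_cast at hl
    refine ⟨B.br_of_mul_gen_step hn (fun J a ha i hi hl => (ih J a ha i hi hl).2) ha hi
      (by omega), fun h => ?_⟩
    have key := B.flip.br_of_mul_gen_step (L := L) hn (J := J) (a := a) (i := n - 1 - i) ?_
      (by rwa [Mon.flip]) (by omega) (by rw [B.len_flip ha]; omega)
    · simpa only [br_flip, image_flip_Ico, image_flip_Iio_pred,
        show n - 1 - (n - 1 - i) = i by omega, h, true_imp_iff] using key
    · intro J a ha i hi hl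
      rw [Mon.flip] at ha
      rw [B.len_flip ha] at hl
      simp only [br_flip, image_flip_Ico, image_flip_Iio_pred]
      exact (ih J a ha (n - 1 - i) (by omega) hl).1

theorem br_left (B : BraidLike s n) (hn : 2 ≤ n) {J : ℕ} {x c : Γ} (hx : x ∈ Mon s (Set.Iio n))
    (hc : c ∈ Mon s (Set.Iio n)) (h : Br s n (Set.Ico 1 n) (Set.Iio (n - 1)) J (x * c)) :
    Br s n (Set.Ico 1 n) (Set.Iio (n - 1)) J x :=
  B.br_left_of_gen (fun a ha i hi _ =>
    (B.br_of_mul_gen hn ((B.len a).toNat + 1) J a ha i hi (by push_cast; omega)).1)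
    hx hc le_rfl h

theorem br_left' (B : BraidLike s n) (hn : 2 ≤ n) {J : ℕ} {x c : Γ} (hx : x ∈ Mon s (Set.Iio n))
    (hc : c ∈ Mon s (Set.Iio n)) (h : Br s n (Set.Iio (n - 1)) (Set.Ico 1 n) J (x * c)) :
    Br s n (Set.Iio (n - 1)) (Set.Ico 1 n) J x :=
  B.br_left_of_gen (fun a ha i hi _ =>
    (B.br_of_mul_gen hn ((B.len a).toNat + 1) J a ha i hi (by push_cast; omega)).2)
    hx hc le_rfl h

theorem br_mul (B : BraidLike s n) (hn : 2 ≤ n) {J : ℕ} {x t : Γ} (hx : x ∈ Mon s (Set.Iio n))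
    (ht : t ∈ Mon s (Set.Ico 1 n)) (h : Br s n (Set.Iio (n - 1)) (Set.Ico 1 n) J x) :
    Br s n (Set.Ico 1 n) (Set.Iio (n - 1)) (J + 1) (x * t) := by
  have h₁ : Set.Ico 1 n ⊆ Set.Iio n := fun j hj => hj.2
  obtain ⟨z, hz⟩ := B.exists_isStrip h₁ hx
  exact ⟨z, hz.mul ht, B.br_left' hn hz.1 (Mon.mono s h₁ hz.2.1) (by rwa [mul_inv_cancel_left])⟩

theorem br_mul' (B : BraidLike s n) (hn : 2 ≤ n) {J : ℕ} {x t : Γ} (hx : x ∈ Mon s (Set.Iio n))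
    (ht : t ∈ Mon s (Set.Iio (n - 1))) (h : Br s n (Set.Ico 1 n) (Set.Iio (n - 1)) J x) :
    Br s n (Set.Iio (n - 1)) (Set.Ico 1 n) (J + 1) (x * t) := by
  have h₀ : Set.Iio (n - 1) ⊆ Set.Iio n := Set.Iio_subset_Iio (by omega)
  obtain ⟨z, hz⟩ := B.exists_isStrip h₀ hx
  exact ⟨z, hz.mul ht, B.br_left hn hz.1 (Mon.mono s h₀ hz.2.1) (by rwa [mul_inv_cancel_left])⟩

theorem noTail_mul_desc (B : BraidLike s n) {y : Γ} (hy : y ∈ Mon s (Set.Iio n))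
    (h : NoTail s n (Set.Iio (n - 1)) y) : NoTail s n (Set.Ico 1 n) (y * desc s n) := by
  have := B.flip.noTail_mul_asc (y := y) (by rwa [Mon.flip])
    (by rwa [noTail_flip, image_flip_Ico])
  rwa [noTail_flip, image_flip_Iio_pred, asc_flip] at this

end BraidLike

end BraidWord

/-! ### The central element -/

namespace BraidWord

variable {Γ : Type*} [Group Γ] {s : ℕ → Γ} {n : ℕ}

/-- The square of the fundamental braid on the generators `s 0, …, s (n - 1)`. -/
def gar (s : ℕ → Γ) (n : ℕ) : Γ := asc s n ^ (n + 1)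

theorem gar_mem (s : ℕ → Γ) (n : ℕ) : gar s n ∈ Mon s (Set.Iio n) :=
  pow_mem (asc_mem fun _ h => h) _

theorem Rels.gar_comm (R : Rels s n) {x : Γ} (hx : x ∈ Grp s (Set.Iio n)) :
    Commute (gar s n) x := by
  induction hx using Subgroup.closure_induction with
  | mem x hx => obtain ⟨i, hi, rfl⟩ := hx; exact R.asc_pow_central hi
  | one => exact Commute.one_right _
  | mul x y _ _ hx hy => exact hx.mul_right hy
  | inv x _ hx => exact hx.inv_right

theorem Rels.gar_pow_comm (R : Rels s n) {x : Γ} (hx : x ∈ Grp s (Set.Iio n)) (k : ℕ) :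
    x * (gar s n ^ k)⁻¹ = (gar s n ^ k)⁻¹ * x :=
  ((R.gar_comm hx).pow_left k).inv_left.eq.symm

theorem Rels.gar_mul_inv_mem (R : Rels s n) {i : ℕ} (hi : i < n) :
    gar s n * (s i)⁻¹ ∈ Mon s (Set.Iio n) := by
  obtain ⟨y, hy, h⟩ := R.dvd_asc_pow hi
  have hc := R.gar_comm (Grp.gen_mem s (show i ∈ Set.Iio n from hi))
  rw [hc.inv_right.eq, gar, h, inv_mul_cancel_left]
  exact hy

theorem Rels.exists_frac (R : Rels s n) {x : Γ} (hx : x ∈ Grp s (Set.Iio n)) :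
    ∃ c ∈ Mon s (Set.Iio n), ∃ r : ℕ, x = c * (gar s n ^ (r + 1))⁻¹ := by
  induction hx using Subgroup.closure_induction_right with
  | one => exact ⟨gar s n, gar_mem s n, 0, by simp⟩
  | mul_right x hx y hy ih =>
    obtain ⟨i, hi, rfl⟩ := hy
    obtain ⟨c, hc, r, rfl⟩ := ih
    refine ⟨c * s i, mul_mem hc (Mon.gen_mem s hi), r, ?_⟩
    rw [mul_assoc, ← R.gar_pow_comm (Grp.gen_mem s hi), mul_assoc]
  | mul_inv_cancel x hx y hy ih =>
    obtain ⟨i, hi, rfl⟩ := hy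
    obtain ⟨c, hc, r, rfl⟩ := ih
    refine ⟨c * (gar s n * (s i)⁻¹), mul_mem hc (R.gar_mul_inv_mem hi), r + 1, ?_⟩
    rw [pow_succ' _ (r + 1), mul_inv_rev, mul_assoc, ← R.gar_pow_comm (inv_mem (Grp.gen_mem s hi)),
      (R.gar_comm (Grp.gen_mem s hi)).inv_right.eq]
    group

theorem Rels.asc_pow_mul_desc (R : Rels s n) {k : ℕ} (hk : k ≤ n) :
    asc s n ^ (k + 1) * desc s (n - k) =
      asc (fun i => s (i + 1)) (n - 1) ^ k * (asc s n * desc s n) := by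
  induction k with
  | zero => simp
  | succ k ih =>
    have e₁ : asc (fun i => s (i + 1)) (n - 1) * asc s n * s (n - 1) = asc s n ^ 2 := by
      have : asc s n = asc s (n - 1) * s (n - 1) := by
        rw [← asc.eq_2, Nat.succ_eq_add_one, Nat.sub_add_cancel (by omega)]
      rw [← R.asc_mul_asc (by omega), mul_assoc, ← this, sq]
    have e₂ := R.asc_pow_mul (i := n - 1 - k) (k := k) (by omega)
    rw [show n - 1 - k + k = n - 1 by omega] at e₂
    rw [pow_succ' (asc (fun i => s (i + 1)) (n - 1)), mul_assoc, ← ih (by omega),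
      show n - k = n - (k + 1) + 1 by omega, desc, show n - (k + 1) = n - 1 - k by omega,
      show k + 1 + 1 = 2 + k by omega, pow_add, ← e₁, pow_succ' _ k]
    simp only [mul_assoc]
    rw [← mul_assoc (asc s n ^ k) (s _), e₂]
    simp only [mul_assoc]

theorem Rels.gar_eq (R : Rels s n) :
    gar s n = asc (fun i => s (i + 1)) (n - 1) ^ n * (asc s n * desc s n) := by
  rw [← R.asc_pow_mul_desc le_rfl, gar, Nat.sub_self, desc, mul_one]

theorem Rels.asc_mul_desc (R : Rels s n) {k : ℕ} (hk : k < n) :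
    asc s n * desc s k = desc (fun i => s (i + 1)) k * asc s n := by
  induction k with
  | zero => simp [desc]
  | succ k ih =>
    rw [desc, desc, ← mul_assoc, R.asc_mul (by omega) le_rfl, mul_assoc, ih (by omega), mul_assoc]

theorem Rels.asc_pow_eq (R : Rels s n) {k : ℕ} (hk : k ≤ n) :
    asc s n ^ (k + 1) = desc s k * asc s n * asc s (n - 1) ^ k := by
  induction k with
  | zero => simp [desc]
  | succ k ih =>
    have e : asc s n = s 0 * asc (fun i => s (i + 1)) (n - 1) := by
      rw [← asc_succ', Nat.sub_add_cancel (by omega)]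
    rw [pow_succ', ih (by omega), pow_succ' (asc s (n - 1)), desc_succ']
    simp only [mul_assoc]
    rw [← mul_assoc (asc s n) (asc s (n - 1)), R.asc_mul_asc (by omega)]
    simp only [← mul_assoc]
    rw [R.asc_mul_desc (by omega), mul_assoc _ (s 0), ← e]

theorem Rels.gar_eq' (R : Rels s n) :
    gar s n = desc s n * asc s n * asc s (n - 1) ^ n := R.asc_pow_eq le_rfl

theorem Rels.theta_comm (R : Rels s n) {x : Γ} (hx : x ∈ Mon s (Set.Ico 1 n)) :
    Commute (asc s n * desc s n) x := by
  induction hx using Mon.induction_right with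
  | one => exact Commute.one_right _
  | mul x hx i hi ih =>
    refine ih.mul_right ?_
    obtain ⟨h₁, h₂⟩ := hi
    obtain ⟨i, rfl⟩ : ∃ j, i = j + 1 := ⟨i - 1, by omega⟩
    rw [Commute, SemiconjBy, mul_assoc, ← R.mul_desc h₂ le_rfl, ← mul_assoc,
      R.asc_mul h₂ le_rfl, mul_assoc]

theorem Rels.asc_conj_mem (R : Rels s n) {g : Γ} (hg : g ∈ Grp s (Set.Iio (n - 1))) :
    asc s n * g * (asc s n)⁻¹ ∈ Grp s (Set.Ico 1 n) := by
  induction hg using Subgroup.closure_induction with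
  | mem x hx =>
    obtain ⟨i, hi, rfl⟩ := hx
    have hi' : i < n - 1 := hi
    rw [R.asc_mul (by omega) le_rfl, mul_inv_cancel_right]
    exact Grp.gen_mem s ⟨by omega, by omega⟩
  | one => simp
  | mul x y _ _ hx hy => simpa [mul_assoc] using mul_mem hx hy
  | inv x _ hx => simpa [mul_assoc] using inv_mem hx

theorem asc_pred_mem (s : ℕ → Γ) (hn : 1 ≤ n) :
    ∃ c ∈ Mon s (Set.Ico 1 n), asc s n = s 0 * c := by
  obtain ⟨c, hc, h⟩ := asc_split s hn
  exact ⟨c, hc, by simpa [asc] using h⟩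

theorem shift_asc_mem (s : ℕ → Γ) (n : ℕ) :
    asc (fun i => s (i + 1)) (n - 1) ∈ Mon s (Set.Ico 1 n) := by
  have := asc_mem (s := fun i => s (i + 1)) (A := Set.Iio (n - 1)) (m := n - 1) fun i hi => hi
  rw [← Mon, Mon.comp s (fun i => i + 1)] at this
  exact Mon.mono s (by rintro _ ⟨i, hi, rfl⟩; simp at *; omega) this

/-! ### Negative elements as products of conjugates -/

/-- The positive elements of level `p`: products of elements `g * s p * h` where `g` and `h` lie
in the subgroup generated by the later generators. -/
def Sig (s : ℕ → Γ) (n p : ℕ) : Subsemigroup Γ :=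
  Subsemigroup.closure {x | ∃ g ∈ Grp s (Set.Ico (p + 1) n), ∃ h ∈ Grp s (Set.Ico (p + 1) n),
    x = g * s p * h}

theorem Sig.gen_mem {p : ℕ} {g h : Γ} (hg : g ∈ Grp s (Set.Ico (p + 1) n))
    (hh : h ∈ Grp s (Set.Ico (p + 1) n)) : g * s p * h ∈ Sig s n p :=
  Subsemigroup.subset_closure ⟨g, hg, h, hh, rfl⟩

theorem Sig.mul_left {p : ℕ} {g x : Γ} (hg : g ∈ Grp s (Set.Ico (p + 1) n))
    (hx : x ∈ Sig s n p) : g * x ∈ Sig s n p := by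
  induction hx using Subsemigroup.closure_induction with
  | mem x hx =>
    obtain ⟨g', hg', h, hh, rfl⟩ := hx
    rw [← mul_assoc, ← mul_assoc]
    exact Sig.gen_mem (mul_mem hg hg') hh
  | mul x y _ hy hx _ => rw [← mul_assoc]; exact mul_mem hx hy

theorem Sig.mul_right {p : ℕ} {g x : Γ} (hg : g ∈ Grp s (Set.Ico (p + 1) n))
    (hx : x ∈ Sig s n p) : x * g ∈ Sig s n p := by
  induction hx using Subsemigroup.closure_induction with
  | mem x hx =>
    obtain ⟨g', hg', h, hh, rfl⟩ := hx
    rw [mul_assoc]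
    exact Sig.gen_mem hg' (mul_mem hh hg)
  | mul x y hx _ _ hy => rw [mul_assoc]; exact mul_mem hx hy

/-- The negative elements of level `0`, without the requirement that the fraction be reduced. -/
def Neg (s : ℕ → Γ) (n : ℕ) (α : Γ) : Prop :=
  ∃ k : ℕ, ∃ a ∈ Mon s (Set.Iio n), Br s n (Set.Ico 1 n) (Set.Iio (n - 1)) (2 * k + 3) a ∧
    α = a * (gar s n ^ (k + 1))⁻¹

namespace BraidLike

theorem isStrip_mul_gar (B : BraidLike s n) {b y : Γ} (h : IsStrip s n (Set.Ico 1 n) b y) :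
    IsStrip s n (Set.Ico 1 n) (b * gar s n) (y * (asc s n * desc s n)) := by
  have hU : asc s n ∈ Mon s (Set.Iio n) := asc_mem fun _ h => h
  have hD : desc s n ∈ Mon s (Set.Iio n) := desc_mem fun _ h => h
  have hc := pow_mem (shift_asc_mem s n) n
  refine ⟨mul_mem h.1 (mul_mem hU hD), ?_, ?_⟩
  · have e : (y * (asc s n * desc s n))⁻¹ * (b * gar s n) =
        y⁻¹ * b * asc (fun i => s (i + 1)) (n - 1) ^ n := by
      rw [inv_mul_eq_iff_eq_mul, B.gar_eq, mul_assoc y,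
        (B.theta_comm (mul_mem h.2.1 hc)).eq]
      simp only [mul_assoc, mul_inv_cancel_left]
    rw [e]
    exact mul_mem h.2.1 hc
  · rw [← mul_assoc]
    exact B.noTail_mul_desc (mul_mem h.1 hU) (B.noTail_mul_asc h.1 h.2.2)

theorem br_mul_gar_aux (B : BraidLike s n)
    (hn : 2 ≤ n) {J : ℕ} {b y : Γ} (h : IsStrip s n (Set.Ico 1 n) b y) :
    Br s n (Set.Ico 1 n) (Set.Iio (n - 1)) (J + 3) (b * gar s n) ↔
      Br s n (Set.Iio (n - 1)) (Set.Ico 1 n) J (y * s 0) := by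
  have h₁ : Set.Ico 1 n ⊆ Set.Iio n := fun j hj => hj.2
  have h₀ : Set.Iio (n - 1) ⊆ Set.Iio n := Set.Iio_subset_Iio (by omega)
  have hU : asc s n ∈ Mon s (Set.Iio n) := asc_mem fun _ h => h
  have g₀ : s 0 ∈ Mon s (Set.Iio n) := Mon.gen_mem s (show 0 < n by omega)
  have g₁ : s (n - 1) ∈ Mon s (Set.Iio n) := Mon.gen_mem s (show n - 1 < n by omega)
  rw [B.br_iff h₁ (B.isStrip_mul_gar h)]
  have hno := B.noTail_mul_asc h.1 h.2.2
  have hs₂ : IsStrip s n (Set.Iio (n - 1)) (y * (asc s n * desc s n))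
      (y * asc s n * s (n - 1)) := by
    have e : y * (asc s n * desc s n) = y * asc s n * s (n - 1) * desc s (n - 1) := by
      have : desc s n = s (n - 1) * desc s (n - 1) := by
        rw [← desc.eq_2, Nat.succ_eq_add_one, Nat.sub_add_cancel (by omega)]
      rw [this]
      simp only [mul_assoc]
    rw [e]
    refine NoTail.isStrip_mul (mul_mem (mul_mem h.1 hU) g₁) (fun i hi hdiv => ?_)
      (desc_mem fun _ h => h)
    have hi' : i < n - 1 := hi
    exact hno i hi (B.div_of_mul (by omega) (by omega) (by omega) (mul_mem h.1 hU) hdiv)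
  rw [B.br_iff h₀ hs₂]
  have hs₃ : IsStrip s n (Set.Ico 1 n) (y * asc s n * s (n - 1)) (y * s 0) := by
    obtain ⟨c, hc, e⟩ := asc_pred_mem s (show 1 ≤ n by omega)
    rw [e, ← mul_assoc, mul_assoc]
    refine NoTail.isStrip_mul (mul_mem h.1 g₀) (fun i hi hdiv => ?_)
      (mul_mem hc (Mon.gen_mem s ⟨by omega, by omega⟩))
    exact h.2.2 i hi (B.div_of_mul (by omega) hi.2 (by have := hi.1; omega) h.1 hdiv)
  rw [B.br_iff h₁ hs₃]

theorem br_mul_gar (B : BraidLike s n) (hn : 2 ≤ n) {J : ℕ} {b : Γ} (hb : b ∈ Mon s (Set.Iio n)) :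
    Br s n (Set.Ico 1 n) (Set.Iio (n - 1)) (J + 4) (b * gar s n) ↔
      Br s n (Set.Ico 1 n) (Set.Iio (n - 1)) (J + 2) b := by
  have h₁ : Set.Ico 1 n ⊆ Set.Iio n := fun j hj => hj.2
  obtain ⟨y, hy⟩ := B.exists_isStrip h₁ hb
  rw [B.br_mul_gar_aux hn hy, B.br_iff h₁ hy, B.br_mul_iff (Set.Iio_subset_Iio (by omega)) hy.1
    (Mon.gen_mem s (show 0 < n - 1 by omega))]

theorem not_br_mul_gar (B : BraidLike s n) (hn : 2 ≤ n) {b : Γ} (hb : b ∈ Mon s (Set.Iio n)) :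
    ¬ Br s n (Set.Ico 1 n) (Set.Iio (n - 1)) 3 (b * gar s n) := by
  obtain ⟨y, hy⟩ := B.exists_isStrip (A := Set.Ico 1 n) (fun j hj => hj.2) hb
  rw [B.br_mul_gar_aux (J := 0) hn hy]
  intro h
  have e : B.len (y * s 0) = 0 := by rw [show y * s 0 = 1 from h, B.len_one]
  rw [B.len_mul, B.len_gen (by omega)] at e
  have := B.len_nonneg hy.1
  omega

theorem not_br_gar_pow (B : BraidLike s n) (hn : 2 ≤ n) (k : ℕ) :
    ¬ Br s n (Set.Ico 1 n) (Set.Iio (n - 1)) (2 * k + 3) (gar s n ^ (k + 1)) := by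
  induction k with
  | zero => simpa using B.not_br_mul_gar hn (one_mem _)
  | succ k ih =>
    rw [pow_succ, show 2 * (k + 1) + 3 = 2 * k + 1 + 4 by omega,
      B.br_mul_gar hn (pow_mem (gar_mem s n) _)]
    exact ih

theorem br_gar_pow (B : BraidLike s n) (hn : 2 ≤ n) (k : ℕ) :
    Br s n (Set.Ico 1 n) (Set.Iio (n - 1)) (2 * k + 2) (gar s n ^ k) := by
  induction k with
  | zero =>
    exact B.br_mono (J := 0) (fun j hj => hj.2) (Set.Iio_subset_Iio (by omega)) (by omega)
      (pow_zero _)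
  | succ k ih =>
    rw [pow_succ, show 2 * (k + 1) + 2 = 2 * k + 4 by omega,
      B.br_mul_gar hn (pow_mem (gar_mem s n) _)]
    exact ih

theorem exists_br (B : BraidLike s n) (hn : 2 ≤ n) {a : Γ} (ha : a ∈ Mon s (Set.Iio n)) :
    ∃ J, Br s n (Set.Ico 1 n) (Set.Iio (n - 1)) (J + 1) a := by
  have h₁ : Set.Ico 1 n ⊆ Set.Iio n := fun j hj => hj.2
  induction ha using Mon.induction_right with
  | one => exact ⟨0, 1, B.isStrip_one h₁ (one_mem _), rfl⟩
  | mul a ha i hi ih =>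
    obtain ⟨J, h⟩ := ih
    rcases Nat.eq_zero_or_pos i with rfl | hi₁
    · have := B.br_mul' hn ha (Mon.gen_mem s (show 0 < n - 1 by omega)) h
      exact ⟨J + 2, by simpa using B.br_mul hn (mul_mem ha (Mon.gen_mem s hi)) (one_mem _) this⟩
    · exact ⟨J, (B.br_mul_iff h₁ ha (Mon.gen_mem s ⟨hi₁, hi⟩)).2 h⟩

open GarsideOrder

theorem bh_le_iff (B : BraidLike s n) (hn : 2 ≤ n) {a : Γ} (ha : a ∈ Mon s (Set.Iio n)) (J : ℕ) :
    bh (Mon s (Set.Iio n)) (Mon s (Set.Ico 1 n)) (Mon s (Set.Iio (n - 1))) a ≤ J + 1 ↔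
      Br s n (Set.Ico 1 n) (Set.Iio (n - 1)) (J + 1) a := by
  have h₁ : Set.Ico 1 n ⊆ Set.Iio n := fun j hj => hj.2
  have h₀ : Set.Iio (n - 1) ⊆ Set.Iio n := Set.Iio_subset_Iio (by omega)
  simp only [bh, B.strip_eq_one_iff h₁ h₀ _ ha]
  constructor
  · intro h
    obtain ⟨J', h'⟩ := B.exists_br hn ha
    have := Nat.sInf_mem (s := {p | 1 ≤ p ∧ Br s n (Set.Ico 1 n) (Set.Iio (n - 1)) p a})
      ⟨J' + 1, by omega, h'⟩
    exact B.br_mono h₁ h₀ h this.2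
  · exact fun h => Nat.sInf_le ⟨by omega, h⟩

theorem negative_iff (B : BraidLike s n) (hn : 2 ≤ n) (α : Γ) :
    Negative (Mon s (Set.Iio n)) (Mon s (Set.Ico 1 n)) (Mon s (Set.Iio (n - 1))) (gar s n) α ↔
      Neg s n α := by
  have hd : ∀ a ∈ Mon s (Set.Iio n), ∀ k,
      dpt (Mon s (Set.Iio n)) (Mon s (Set.Ico 1 n)) (Mon s (Set.Iio (n - 1))) a <
        dpt (Mon s (Set.Iio n)) (Mon s (Set.Ico 1 n)) (Mon s (Set.Iio (n - 1)))
          (gar s n ^ (k + 1)) ↔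
      Br s n (Set.Ico 1 n) (Set.Iio (n - 1)) (2 * k + 3) a := by
    intro a ha k
    have hg := pow_mem (gar_mem s n) (k + 1)
    have e₁ := (B.bh_le_iff hn hg _).not.2 (B.not_br_gar_pow hn k)
    have e₂ := (B.bh_le_iff hn hg _).2 (B.br_gar_pow hn (k + 1))
    rw [← B.bh_le_iff hn ha, dpt, dpt]
    omega
  constructor
  · rintro ⟨a, k, ⟨ha, -⟩, hk, rfl, h⟩
    obtain ⟨k, rfl⟩ : ∃ j, k = j + 1 := ⟨k - 1, by omega⟩
    exact ⟨k, a, ha, (hd a ha k).1 h, rfl⟩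
  · rintro ⟨k, a, ha, h, rfl⟩
    induction k generalizing a with
    | zero =>
      refine ⟨a, 1, ⟨ha, fun hdiv => ?_⟩, le_rfl, rfl, (hd a ha 0).2 h⟩
      exact B.not_br_mul_gar hn hdiv (by simpa using h)
    | succ k ih =>
      by_cases hdiv : a * (gar s n)⁻¹ ∈ Mon s (Set.Iio n)
      · have := ih _ hdiv ((B.br_mul_gar (J := 2 * k + 1) hn hdiv).1
          (by rwa [inv_mul_cancel_right]))
        rwa [mul_assoc, ← mul_inv_rev, ← pow_succ] at this
      · exact ⟨a, k + 2, ⟨ha, hdiv⟩, by omega, rfl, (hd a ha (k + 1)).2 h⟩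

theorem neg_mul_gen (B : BraidLike s n) {α : Γ} (h : Neg s n α) {i : ℕ} (hi : i ∈ Set.Ico 1 n) :
    Neg s n (α * s i) := by
  obtain ⟨k, a, ha, h, rfl⟩ := h
  refine ⟨k, a * s i, mul_mem ha (Mon.gen_mem s hi.2),
    (B.br_mul_iff (fun j hj => hj.2) ha (Mon.gen_mem s hi)).2 h, ?_⟩
  rw [mul_assoc, mul_assoc, B.gar_pow_comm (Grp.gen_mem s hi.2)]

theorem neg_mul_inv (B : BraidLike s n) (hn : 2 ≤ n) {α : Γ} (h : Neg s n α) {i : ℕ} (hi : i < n) :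
    Neg s n (α * (s i)⁻¹) := by
  obtain ⟨k, a, ha, h, rfl⟩ := h
  have hg := B.gar_mul_inv_mem hi
  have hgi := Grp.gen_mem s (show i ∈ Set.Iio n from hi)
  refine ⟨k + 1, a * (gar s n * (s i)⁻¹), mul_mem ha hg, ?_, ?_⟩
  · refine B.br_left hn (mul_mem ha hg) (Mon.gen_mem s hi) ?_
    rw [mul_assoc, inv_mul_cancel_right]
    exact (B.br_mul_gar hn ha).2 h
  · rw [pow_succ' _ (k + 1), mul_inv_rev, mul_assoc, ← B.gar_pow_comm (inv_mem hgi),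
      (B.gar_comm hgi).inv_right.eq]
    group

theorem neg_mul_grp (B : BraidLike s n)
    (hn : 2 ≤ n) {α g : Γ} (h : Neg s n α) (hg : g ∈ Grp s (Set.Ico 1 n)) :
    Neg s n (α * g) := by
  induction hg using Subgroup.closure_induction_right with
  | one => simpa using h
  | mul_right x hx y hy ih =>
    obtain ⟨i, hi, rfl⟩ := hy
    rw [← mul_assoc]
    exact B.neg_mul_gen ih hi
  | mul_inv_cancel x hx y hy ih =>
    obtain ⟨i, hi, rfl⟩ := hy
    rw [← mul_assoc]
    exact B.neg_mul_inv hn ih hi.2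

theorem neg_grp_mul_inv (B : BraidLike s n) (hn : 2 ≤ n) {g : Γ} (hg : g ∈ Grp s (Set.Ico 1 n)) :
    Neg s n (g * (s 0)⁻¹) := by
  have h₁ : Set.Ico 1 n ⊆ Set.Iio n := fun j hj => hj.2
  have h₀ : Set.Iio (n - 1) ⊆ Set.Iio n := Set.Iio_subset_Iio (by omega)
  have g₀ : s 0 ∈ Mon s (Set.Iio (n - 1)) := Mon.gen_mem s (show 0 < n - 1 by omega)
  obtain ⟨c, hc, r, e⟩ : ∃ c ∈ Mon s (Set.Ico 1 n), ∃ r : ℕ,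
      g = c * ((asc (fun i => s (i + 1)) (n - 1) ^ n) ^ (r + 1))⁻¹ := by
    have hs : (fun i => 1 + i) '' Set.Iio (n - 1) = Set.Ico 1 n := by
      ext j
      simp only [Set.mem_image, Set.mem_Iio, Set.mem_Ico]
      exact ⟨by rintro ⟨i, h, rfl⟩; omega, fun h => ⟨j - 1, by omega, by omega⟩⟩
    have := (B.shift 1).exists_frac (x := g) (by rwa [Grp.comp s (fun i => 1 + i), hs])
    rw [Mon.comp s (fun i => 1 + i), hs, gar, Nat.sub_add_cancel (by omega)] at this
    simpa only [Nat.add_comm 1] using this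
  obtain ⟨u, hu, eu⟩ := asc_pred_mem s (show 1 ≤ n by omega)
  obtain ⟨d, hd, ed⟩ := desc_pred_mem s (show 1 ≤ n by omega)
  set θ := asc s n * desc s n with hθ
  have eθ : θ = s 0 * (u * d) * s 0 := by rw [hθ, eu, ed]; simp only [mul_assoc]
  have hθm : θ ∈ Mon s (Set.Iio n) :=
    mul_mem (asc_mem fun _ h => h) (desc_mem fun _ h => h)
  have hcm := Mon.mono s h₁ hc
  have hm : ∀ r, c * θ ^ r * s 0 ∈ Mon s (Set.Iio n) := fun r =>
    mul_mem (mul_mem hcm (pow_mem hθm r)) (Mon.mono s h₀ g₀)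
  have Q : ∀ r, Br s n (Set.Iio (n - 1)) (Set.Ico 1 n) (2 * r + 2) (c * θ ^ r * s 0) := by
    intro r
    induction r with
    | zero =>
      rw [pow_zero, mul_one]
      exact B.br_mul' hn hcm g₀ ⟨1, B.isStrip_one h₁ hc, rfl⟩
    | succ r ih =>
      have := B.br_mul' hn (mul_mem (hm r) (Mon.mono s h₁ (mul_mem hu hd))) (mul_mem g₀ g₀)
        (B.br_mul hn (hm r) (mul_mem hu hd) ih)
      rw [pow_succ]
      nth_rw 2 [eθ]
      rw [show 2 * (r + 1) + 2 = 2 * r + 2 + 1 + 1 by omega]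
      simpa only [mul_assoc] using this
  refine ⟨r, c * θ ^ r * s 0 * (u * d), mul_mem (hm r) (Mon.mono s h₁ (mul_mem hu hd)),
    B.br_mul hn (hm r) (mul_mem hu hd) (Q r), ?_⟩
  set δ := asc (fun i => s (i + 1)) (n - 1) ^ n with hδ
  have hδm : δ ∈ Mon s (Set.Ico 1 n) := pow_mem (shift_asc_mem s n) n
  have eg : gar s n = δ * θ := B.gar_eq
  have hcomm : Commute θ δ := B.theta_comm hδm
  have hgc := (B.gar_comm (Grp.gen_mem s (show 0 ∈ Set.Iio n by simp; omega))).pow_left (r + 1)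
  rw [e, eq_mul_inv_iff_mul_eq, mul_assoc _ (s 0)⁻¹, ← hgc.inv_right.eq, eg,
    hcomm.symm.mul_pow, ← mul_assoc, mul_assoc c, inv_mul_cancel_left, pow_succ, eθ]
  simp [mul_assoc]

theorem neg_of_sig (B : BraidLike s n) (hn : 2 ≤ n) {α : Γ} (h : α ∈ Sig s n 0) : Neg s n α⁻¹ := by
  suffices H : Neg s n α⁻¹ ∧ ∀ ν, Neg s n ν → Neg s n (ν * α⁻¹) from H.1
  induction h using Subsemigroup.closure_induction with
  | mem x hx =>
    obtain ⟨g, hg, h, hh, rfl⟩ := hx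
    simp only [mul_inv_rev, ← mul_assoc]
    exact ⟨B.neg_mul_grp hn (B.neg_grp_mul_inv hn (inv_mem hh)) (inv_mem hg), fun ν hν =>
      B.neg_mul_grp hn (B.neg_mul_inv hn (B.neg_mul_grp hn hν (inv_mem hh)) (by omega))
        (inv_mem hg)⟩
  | mul x y _ _ hx hy =>
    simp only [mul_inv_rev, ← mul_assoc]
    exact ⟨hx.2 _ hy.1, fun ν hν => hx.2 _ (hy.2 _ hν)⟩

theorem gar_mul_inv_sig (B : BraidLike s n)
    (hn : 2 ≤ n) {v : Γ} (hv : v ∈ Mon s (Set.Iio (n - 1))) :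
    gar s n * v⁻¹ ∈ Sig s n 0 := by
  obtain ⟨u, hu, eu⟩ := asc_pred_mem s (show 1 ≤ n by omega)
  obtain ⟨d, hd, ed⟩ := desc_pred_mem s (show 1 ≤ n by omega)
  have hΛ : asc s (n - 1) ^ n * v⁻¹ ∈ Grp s (Set.Iio (n - 1)) :=
    mul_mem (pow_mem (Mon.le_Grp s _ (asc_mem fun _ h => h)) n) (inv_mem (Mon.le_Grp s _ hv))
  have hh := B.asc_conj_mem hΛ
  set h := asc s n * (asc s (n - 1) ^ n * v⁻¹) * (asc s n)⁻¹ with eh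
  have e : gar s n * v⁻¹ = d * s 0 * h * (1 * s 0 * u) := by
    rw [one_mul, ← eu, ← ed, eh, B.gar_eq']
    simp [mul_assoc]
  rw [e]
  exact mul_mem (Sig.gen_mem (Mon.le_Grp s _ hd) hh)
    (Sig.gen_mem (one_mem _) (Mon.le_Grp s _ hu))

theorem sig_of_br (B : BraidLike s n) (hn : 2 ≤ n) (k : ℕ) {a : Γ}
    (h : Br s n (Set.Ico 1 n) (Set.Iio (n - 1)) (2 * k + 3) a) :
    gar s n ^ (k + 1) * a⁻¹ ∈ Sig s n 0 := by
  have h₀ : Set.Iio (n - 1) ⊆ Set.Iio n := Set.Iio_subset_Iio (by omega)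
  have key : ∀ k : ℕ, ∀ a y z : Γ, y⁻¹ * a ∈ Mon s (Set.Ico 1 n) →
      z⁻¹ * y ∈ Mon s (Set.Iio (n - 1)) → gar s n ^ (k + 1) * a⁻¹ =
        (y⁻¹ * a)⁻¹ * (gar s n * (z⁻¹ * y)⁻¹) * (gar s n ^ k * z⁻¹) := by
    intro k a y z hy hz
    have e₁ := ((B.gar_comm (inv_mem (Mon.le_Grp s _
      (Mon.mono s (fun j hj => hj.2) hy)))).pow_left (k + 1)).eq
    have e₂ := ((B.gar_comm (inv_mem (Mon.le_Grp s _ (Mon.mono s h₀ hz)))).pow_left k).eq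
    calc gar s n ^ (k + 1) * a⁻¹
        = gar s n ^ (k + 1) * (y⁻¹ * a)⁻¹ * (z⁻¹ * y)⁻¹ * z⁻¹ := by group
      _ = (y⁻¹ * a)⁻¹ * gar s n * (gar s n ^ k * (z⁻¹ * y)⁻¹) * z⁻¹ := by
        rw [e₁, pow_succ']; group
      _ = _ := by rw [e₂]; group
  induction k generalizing a with
  | zero =>
    obtain ⟨y, hy, z, hz, w, hw, rfl⟩ := h
    rw [key 0 a y z hy.2.1 hz.2.1, pow_zero, one_mul]
    exact Sig.mul_right (inv_mem (Mon.le_Grp s _ (by simpa using hw.2.1)))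
      (Sig.mul_left (inv_mem (Mon.le_Grp s _ hy.2.1)) (B.gar_mul_inv_sig hn hz.2.1))
  | succ k ih =>
    obtain ⟨y, hy, z, hz, h⟩ := h
    rw [key (k + 1) a y z hy.2.1 hz.2.1]
    exact mul_mem (Sig.mul_left (inv_mem (Mon.le_Grp s _ hy.2.1))
      (B.gar_mul_inv_sig hn hz.2.1)) (ih h)

theorem sig_of_neg (B : BraidLike s n) (hn : 2 ≤ n) {α : Γ} (h : Neg s n α) : α⁻¹ ∈ Sig s n 0 := by
  obtain ⟨k, a, ha, h, rfl⟩ := h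
  rw [mul_inv_rev, inv_inv]
  exact B.sig_of_br hn k h

theorem one_notMem_sig (B : BraidLike s n) (hn : 2 ≤ n) : (1 : Γ) ∉ Sig s n 0 := by
  intro h
  obtain ⟨k, a, ha, h, e⟩ := B.neg_of_sig hn h
  rw [inv_one, eq_mul_inv_iff_mul_eq, one_mul] at e
  rw [← e] at h
  exact B.not_br_gar_pow hn k h

theorem negative_iff_sig (B : BraidLike s n) (hn : 2 ≤ n) (α : Γ) :
    Negative (Mon s (Set.Iio n)) (Mon s (Set.Ico 1 n)) (Mon s (Set.Iio (n - 1))) (gar s n) α⁻¹ ↔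
      α ∈ Sig s n 0 := by
  rw [B.negative_iff hn]
  exact ⟨fun h => by simpa using B.sig_of_neg hn h, B.neg_of_sig hn⟩

end BraidLike

end BraidWord

/-! ### Comparison of braids -/

namespace BraidWord

variable {Γ : Type*} [Group Γ] {s : ℕ → Γ} {n : ℕ}

theorem image_add_Iio (p n : ℕ) : (fun i => p + i) '' Set.Iio (n - p) = Set.Ico p n := by
  ext i
  simp only [Set.mem_image, Set.mem_Iio, Set.mem_Ico]
  exact ⟨by rintro ⟨j, hj, rfl⟩; omega, fun h => ⟨i - p, by omega, by omega⟩⟩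

theorem image_add_Ico (p n : ℕ) : (fun i => p + i) '' Set.Ico 1 (n - p) = Set.Ico (p + 1) n := by
  ext i
  simp only [Set.mem_image, Set.mem_Ico]
  exact ⟨by rintro ⟨j, hj, rfl⟩; omega, fun h => ⟨i - p, by omega, by omega⟩⟩

theorem Sig.shift (s : ℕ → Γ) (n p : ℕ) : Sig (fun i => s (p + i)) (n - p) 0 = Sig s n p := by
  rw [Sig, Sig, zero_add, Grp.comp s (fun i => p + i), image_add_Ico]
  rfl

theorem Rels.exists_frac_Ico (R : Rels s n) {q : ℕ} {g : Γ} (hg : g ∈ Grp s (Set.Ico q n)) :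
    ∃ c ∈ Mon s (Set.Ico q n), ∃ d ∈ Mon s (Set.Ico q n), g = c * d⁻¹ ∧ Commute c d := by
  rw [← image_add_Iio, ← Grp.comp s] at hg
  obtain ⟨c, hc, r, e⟩ := (R.shift q).exists_frac hg
  have hd := pow_mem (gar_mem (fun i => s (q + i)) (n - q)) (r + 1)
  have hcd := ((R.shift q).gar_comm (Mon.le_Grp _ _ hc)).pow_left (r + 1)
  rw [Mon.comp s (fun i => q + i), image_add_Iio] at hc hd
  exact ⟨c, hc, _, hd, e, hcd.symm⟩

theorem Ico_succ_subset (p n : ℕ) : Set.Ico (p + 1) n ⊆ Set.Ico p n :=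
  Set.Ico_subset_Ico_left p.le_succ

theorem Ico_subset_Iio (p n : ℕ) : Set.Ico p n ⊆ Set.Iio n := fun _ h => h.2

theorem Rels.comm_grp (R : Rels s n) {p : ℕ} {g : Γ}
    (hg : g ∈ Grp s (Set.Ico (p + 2) n)) : Commute (s p) g := by
  induction hg using Subgroup.closure_induction with
  | mem x hx => obtain ⟨i, hi, rfl⟩ := hx; exact R.comm hi.1 hi.2
  | one => exact Commute.one_right _
  | mul x y _ _ hx hy => exact hx.mul_right hy
  | inv x _ hx => exact hx.inv_right

/-- The left divisors of `w`. -/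
def Dv (s : ℕ → Γ) (n : ℕ) (w : Γ) : Set Γ :=
  {v | v ∈ Mon s (Set.Iio n) ∧ v⁻¹ * w ∈ Mon s (Set.Iio n)}

theorem Dv.of_mul {w v u : Γ} (hv : v ∈ Mon s (Set.Iio n)) (hu : u ∈ Mon s (Set.Iio n))
    (h : v * u ∈ Dv s n w) : v ∈ Dv s n w :=
  ⟨hv, by simpa [mul_assoc] using mul_mem hu h.2⟩

/-- `x` and `z` lie in the same left coset of the subgroup of generators of index `≥ p`. -/
def Cos (s : ℕ → Γ) (n p : ℕ) (x z : Γ) : Prop := x⁻¹ * z ∈ Grp s (Set.Ico p n)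

theorem Cos.refl (s : ℕ → Γ) (n p : ℕ) (x : Γ) : Cos s n p x x := by simp [Cos]

theorem Cos.symm {p : ℕ} {x z : Γ} (h : Cos s n p x z) : Cos s n p z x := by
  simpa [Cos] using inv_mem h

theorem Cos.trans {p : ℕ} {x y z : Γ} (h : Cos s n p x y) (h' : Cos s n p y z) :
    Cos s n p x z := by
  simpa [Cos, mul_assoc] using mul_mem h h'

theorem Cos.of_succ {p : ℕ} {x z : Γ} (h : Cos s n (p + 1) x z) : Cos s n p x z :=
  Grp.mono s (Ico_succ_subset p n) h

theorem Cos.mul_gen {p i : ℕ} (hp : p ≤ i) (hi : i < n) (x : Γ) : Cos s n p x (x * s i) := by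
  rw [Cos, inv_mul_cancel_left]
  exact Grp.gen_mem s ⟨hp, hi⟩

/-- One step between divisors of `w` which multiplies by a single generator of index `p` and
arbitrary elements of larger index. -/
def Edge (s : ℕ → Γ) (n : ℕ) (w : Γ) (p : ℕ) (x z : Γ) : Prop :=
  p < n ∧ x ∈ Dv s n w ∧ z ∈ Dv s n w ∧ ∃ v ∈ Dv s n w, v * s p ∈ Dv s n w ∧
    Cos s n (p + 1) x v ∧ Cos s n (p + 1) (v * s p) z

/-- A nonempty path of edges. -/
abbrev Path (s : ℕ → Γ) (n : ℕ) (w : Γ) (p : ℕ) : Γ → Γ → Prop :=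
  Relation.TransGen (Edge s n w p)

theorem Path.sig {w : Γ} {p : ℕ} {x z : Γ} (h : Path s n w p x z) : x⁻¹ * z ∈ Sig s n p := by
  have key : ∀ {x z}, Edge s n w p x z → x⁻¹ * z ∈ Sig s n p := by
    rintro x z ⟨-, -, -, v, -, -, h₁, h₂⟩
    have := Sig.gen_mem h₁ h₂
    simpa [mul_assoc] using this
  induction h with
  | single h => exact key h
  | tail _ h ih => simpa [mul_assoc] using mul_mem ih (key h)

theorem Path.cos_right {w : Γ} {p : ℕ} {x z z' : Γ} (h : Path s n w p x z)
    (hz : z' ∈ Dv s n w) (hc : Cos s n (p + 1) z z') : Path s n w p x z' := by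
  have key : ∀ {x}, Edge s n w p x z → Edge s n w p x z' := by
    rintro x ⟨hp, hx, -, v, hv, hvs, h₁, h₂⟩
    exact ⟨hp, hx, hz, v, hv, hvs, h₁, h₂.trans hc⟩
  rcases Relation.TransGen.tail'_iff.1 h with ⟨y, h, e⟩
  exact Relation.TransGen.tail'_iff.2 ⟨y, h, key e⟩

theorem Path.cos_left {w : Γ} {p : ℕ} {x x' z : Γ} (h : Path s n w p x z)
    (hx : x' ∈ Dv s n w) (hc : Cos s n (p + 1) x' x) : Path s n w p x' z := by
  have key : ∀ {z}, Edge s n w p x z → Edge s n w p x' z := by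
    rintro z ⟨hp, -, hz, v, hv, hvs, h₁, h₂⟩
    exact ⟨hp, hx, hz, v, hv, hvs, hc.trans h₁, h₂⟩
  rcases Relation.TransGen.head'_iff.1 h with ⟨y, e, h⟩
  exact Relation.TransGen.head'_iff.2 ⟨y, key e, h⟩

/-- A path, possibly trivial modulo the generators of index larger than `p`. -/
def WPath (s : ℕ → Γ) (n : ℕ) (w : Γ) (p : ℕ) (x z : Γ) : Prop :=
  Path s n w p x z ∨ Cos s n (p + 1) x z

theorem WPath.trans_path {w : Γ} {p : ℕ} {x y z : Γ} (hx : x ∈ Dv s n w)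
    (h : WPath s n w p x y) (h' : Path s n w p y z) : Path s n w p x z :=
  h.elim (fun h => h.trans h') fun h => h'.cos_left hx h

theorem WPath.trans_cos {w : Γ} {p : ℕ} {x y z : Γ} (hz : z ∈ Dv s n w)
    (h : WPath s n w p x y) (h' : Cos s n (p + 1) y z) : WPath s n w p x z :=
  h.imp (fun h => h.cos_right hz h') fun h => h.trans h'

theorem WPath.of_mul {w : Γ} {p : ℕ} {x u : Γ} (hx : x ∈ Mon s (Set.Iio n))
    (hu : u ∈ Mon s (Set.Ico p n)) (h : x * u ∈ Dv s n w) : WPath s n w p x (x * u) := by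
  induction hu using Mon.induction_right with
  | one => rw [mul_one]; exact .inr (Cos.refl s n (p + 1) x)
  | mul u hu i hi ih =>
    have hu' := Mon.mono s (Ico_subset_Iio p n) hu
    rw [← mul_assoc] at h ⊢
    have h' := Dv.of_mul (mul_mem hx hu') (Mon.gen_mem s hi.2) h
    have hx' := Dv.of_mul hx hu' h'
    rcases eq_or_lt_of_le hi.1 with rfl | hlt
    · exact .inl ((ih h').trans_path hx' (.single
        ⟨hi.2, h', h, _, h', h, Cos.refl s n (p + 1) _, Cos.refl s n (p + 1) _⟩))
    · exact (ih h').trans_cos h (Cos.mul_gen hlt hi.2 _)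

/-- The last edge of a path, with the target of the rest of the path chosen suitably. -/
theorem Path.last {w : Γ} {p : ℕ} {x t : Γ} (h : Path s n w p x t) :
    p < n ∧ ∃ v ∈ Dv s n w, v * s p ∈ Dv s n w ∧ WPath s n w p x v ∧
      Cos s n (p + 1) (v * s p) t := by
  obtain ⟨y, h, hp, hy, -, v, hv, hvs, h₁, h₂⟩ := Relation.TransGen.tail'_iff.1 h
  refine ⟨hp, v, hv, hvs, ?_, h₂⟩
  rcases Relation.reflTransGen_iff_eq_or_transGen.1 h with rfl | h
  · exact .inr h₁
  · exact .inl (Path.cos_right h hv h₁)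

namespace BraidLike

theorem one_notMem_sig' (B : BraidLike s n) {p : ℕ} (hp : p < n) : (1 : Γ) ∉ Sig s n p := by
  rcases Nat.lt_or_ge (p + 1) n with h | h
  · rw [← Sig.shift]
    exact (B.shift p).one_notMem_sig (by omega)
  · have hbot : Grp s (Set.Ico (p + 1) n) = ⊥ := by
      rw [Set.Ico_eq_empty (by omega), Grp, Set.image_empty, Subgroup.closure_empty]
    have key : ∀ x ∈ Sig s n p, 0 < B.len x := by
      intro x hx
      induction hx using Subsemigroup.closure_induction with
      | mem x hx =>
        obtain ⟨g, hg, h, hh, rfl⟩ := hx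
        rw [hbot, Subgroup.mem_bot] at hg hh
        rw [hg, hh, one_mul, mul_one, B.len_gen hp]
        exact one_pos
      | mul x y _ _ hx hy => rw [B.len_mul]; omega
    exact fun h₁ => absurd (key 1 h₁) (by rw [B.len_one]; omega)

theorem finite_dv (B : BraidLike s n) (w : Γ) : (Dv s n w).Finite := by
  have key : ∀ k : ℕ, {x | x ∈ Mon s (Set.Iio n) ∧ B.len x ≤ k}.Finite := by
    intro k
    induction k with
    | zero =>
      refine (Set.finite_singleton (1 : Γ)).subset fun x hx => ?_
      exact B.eq_one_of_len hx.1 (by simpa using hx.2)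
    | succ k ih =>
      refine ((Set.finite_singleton (1 : Γ)).union
        (Set.Finite.image2 (fun x i => x * s i) ih (Set.finite_Iio n))).subset ?_
      rintro x ⟨hx, hl⟩
      rcases Mon.cases_right hx with rfl | ⟨y, hy, i, hi, rfl⟩
      · exact .inl rfl
      · rw [B.len_mul, B.len_gen hi] at hl
        exact .inr ⟨y, ⟨hy, by push_cast at hl; omega⟩, i, hi, rfl⟩
  refine (key (B.len w).toNat).subset fun v hv => ⟨hv.1, ?_⟩
  have := B.len_nonneg hv.2
  rw [B.len_mul, B.len_inv] at this
  omega

theorem dvd_of_cos (B : BraidLike s n) {p : ℕ} (hp : p < n) {f x : Γ} (hf : f ∈ Mon s (Set.Iio n))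
    (hx : x ∈ Mon s (Set.Iio n)) (h : Cos s n (p + 2) (f * s p) x) :
    ∃ f' ∈ Mon s (Set.Iio n), x = f' * s p ∧ Cos s n (p + 2) f f' := by
  have hcomm := B.comm_grp h
  obtain ⟨c, hc, d, hd, e, -⟩ := B.exists_frac_Ico h
  have hcs := B.comm_grp (Mon.le_Grp s _ hc)
  have e' : f * c * s p = x * d := by
    rw [inv_mul_eq_iff_eq_mul] at e
    rw [e, mul_assoc, ← hcs.eq]
    simp only [mul_assoc, inv_mul_cancel, mul_one]
  obtain ⟨f', hf', -, rfl⟩ := B.peel (A := Set.Ico (p + 2) n)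
    (fun i hi => ⟨hi.2, by have := hi.1; unfold Far; omega⟩) hp
    (mul_mem hf (Mon.mono s (Ico_subset_Iio _ n) hc)) hx hd e'
  refine ⟨f', hf', rfl, ?_⟩
  have : f⁻¹ * f' = (f * s p)⁻¹ * (f' * s p) :=
    mul_right_cancel (b := s p) (by simpa [mul_assoc] using hcomm.eq)
  rw [Cos, this]
  exact h

theorem path_of_path_succ (B : BraidLike s n) {w : Γ} {p : ℕ} {x z : Γ} (hz : z ∈ Mon s (Set.Iio n))
    (h : Path s n w (p + 1) x (z * s p)) :
    ∃ y ∈ Mon s (Set.Iio n), x = y * s p ∧ Path s n w p y z := by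
  have key : ∀ {x t}, Edge s n w (p + 1) x t → ∀ z ∈ Mon s (Set.Iio n), t = z * s p →
      ∃ y ∈ Mon s (Set.Iio n), x = y * s p ∧ Edge s n w p y z := by
    rintro x t ⟨hp, hx, ht, v, hv, hvs, h₁, h₂⟩ z hz rfl
    have hp' : p < n := by omega
    have gp : s p ∈ Mon s (Set.Iio n) := Mon.gen_mem s hp'
    have gp' : s (p + 1) ∈ Mon s (Set.Iio n) := Mon.gen_mem s hp
    obtain ⟨g, hg, e, h₃⟩ := B.dvd_of_cos hp' hz hvs.1 h₂.symm
    rcases B.lcm_right hp hp' hv.1 hg e with h | ⟨h, -⟩ | ⟨-, f, hf, rfl, rfl⟩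
    · omega
    · unfold Far at h; omega
    obtain ⟨y, hy, rfl, h₄⟩ := B.dvd_of_cos hp' (mul_mem hf gp') hx.1 h₁.symm
    have hfs : f * s p ∈ Dv s n w := by
      refine Dv.of_mul (mul_mem hf gp) (mul_mem gp' gp) ?_
      rw [e] at hvs
      simpa only [mul_assoc] using hvs
    exact ⟨y, hy, rfl, hp', Dv.of_mul hy gp hx, Dv.of_mul hz gp ht, f, Dv.of_mul hf gp hfs, hfs,
      h₄.of_succ.symm.trans (Cos.mul_gen le_rfl hp f).symm,
      (Cos.mul_gen le_rfl hp _).trans h₃.of_succ.symm⟩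
  induction h using Relation.TransGen.head_induction_on with
  | single h => obtain ⟨y, hy, e, h⟩ := key h z hz rfl; exact ⟨y, hy, e, .single h⟩
  | head h _ ih =>
    obtain ⟨y, hy, e, h'⟩ := ih
    obtain ⟨y', hy', e', h⟩ := key h y hy e
    exact ⟨y', hy', e', .head h h'⟩

theorem compare_below (B : BraidLike s n) {w : Γ} {p : ℕ}
    (ih : ∀ x ∈ Dv s n w, ∀ z ∈ Dv s n w, Cos s n (p + 1) x z →
      Path s n w (p + 1) x z ∨ Path s n w (p + 1) z x ∨ Cos s n (p + 2) x z)
    {t : Γ} (ht : t ∈ Dv s n w) : ∀ x ∈ Dv s n w, ∀ z ∈ Dv s n w, WPath s n w p x t →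
      WPath s n w p z t → Path s n w p x z ∨ Path s n w p z x ∨ Cos s n (p + 1) x z := by
  rcases Nat.lt_or_ge p n with hp | hp
  swap
  · rintro x - z - (h | h) h'
    · exact absurd h.last.1 (by omega)
    · rcases h' with h' | h'
      · exact absurd h'.last.1 (by omega)
      · exact .inr (.inr (h.trans h'.symm))
  have : IsStrictOrder Γ fun x y => x⁻¹ * y ∈ Sig s n p :=
    { irrefl := fun x h => B.one_notMem_sig' hp (by simpa using h)
      trans := fun x y z h h' => by simpa [mul_assoc] using mul_mem h h' }
  have wf := (B.finite_dv w).wellFoundedOn (r := fun x y => x⁻¹ * y ∈ Sig s n p)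
  refine wf.induction (P := fun t => ∀ x ∈ Dv s n w, ∀ z ∈ Dv s n w, WPath s n w p x t →
    WPath s n w p z t → Path s n w p x z ∨ Path s n w p z x ∨ Cos s n (p + 1) x z)
    ht fun t ht rec => ?_
  intro x hx z hz hxt hzt
  rcases hxt with hxt | hxt
  swap
  · rcases hzt with hzt | hzt
    · exact .inr (.inl (hzt.cos_right hx hxt.symm))
    · exact .inr (.inr (hxt.trans hzt.symm))
  rcases hzt with hzt | hzt
  swap
  · exact .inl (hxt.cos_right hz hzt.symm)
  obtain ⟨-, v, hv, hvs, hxv, hvt⟩ := hxt.last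
  obtain ⟨-, u, hu, hus, hzu, hut⟩ := hzt.last
  have lt : ∀ v, Cos s n (p + 1) (v * s p) t → v⁻¹ * t ∈ Sig s n p := by
    intro v h
    have := Sig.gen_mem (one_mem _) h
    simpa [mul_assoc] using this
  rcases ih _ hvs _ hus (hvt.trans hut.symm) with h | h | h
  · obtain ⟨y, -, e, h⟩ := B.path_of_path_succ hu.1 h
    rw [← mul_right_cancel e] at h
    exact rec u hu (lt u hut) x hx z hz (.inl (hxv.trans_path hx h)) hzu
  · obtain ⟨y, -, e, h⟩ := B.path_of_path_succ hv.1 h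
    rw [← mul_right_cancel e] at h
    exact rec v hv (lt v hvt) x hx z hz hxv (.inl (hzu.trans_path hz h))
  · obtain ⟨f, -, e, h⟩ := B.dvd_of_cos hp hv.1 hus.1 h
    rw [← mul_right_cancel e] at h
    exact rec u hu (lt u hut) x hx z hz (hxv.trans_cos hu h.of_succ) hzu

theorem exists_head (B : BraidLike s n)
    {A : Set ℕ} (hA : A ⊆ Set.Iio n) {x : Γ} (hx : x ∈ Mon s (Set.Iio n)) :
    ∃ k ∈ Mon s A, k⁻¹ * x ∈ Mon s (Set.Iio n) ∧
      ∀ c ∈ Mon s A, c⁻¹ * x ∈ Mon s (Set.Iio n) → c⁻¹ * k ∈ Mon s A := by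
  obtain ⟨y, hy, hk, hno⟩ := B.op.exists_isStrip hA (Mon.mem_op.2 hx)
  obtain ⟨y, rfl⟩ := MulOpposite.op_surjective y
  rw [← MulOpposite.op_inv, ← MulOpposite.op_mul] at hk
  refine ⟨x * y⁻¹, Mon.mem_op.1 hk, by simpa using Mon.mem_op.1 hy, fun c hc h => ?_⟩
  have := B.op.tail_mon hA hy hno hk (Mon.mem_op.2 hc) (by
    rw [← MulOpposite.op_inv, ← MulOpposite.op_mul, ← MulOpposite.op_mul]
    refine Mon.mem_op.2 ?_
    simpa using h)
  rw [← MulOpposite.op_inv, ← MulOpposite.op_mul] at this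
  exact Mon.mem_op.1 this

theorem compare (B : BraidLike s n)
    (w : Γ) (p : ℕ) : ∀ x ∈ Dv s n w, ∀ z ∈ Dv s n w, Cos s n p x z →
    Path s n w p x z ∨ Path s n w p z x ∨ Cos s n (p + 1) x z := by
  rcases Nat.lt_or_ge n p with hp | hp
  · intro x _ z _ h
    right; right
    rw [Cos, Set.Ico_eq_empty (by omega)] at h ⊢
    exact h
  induction hp using Nat.decreasingInduction with
  | self =>
    intro x _ z _ h
    right; right
    rw [Cos, Set.Ico_eq_empty (by omega)] at h ⊢
    exact h
  | of_succ p hp ih =>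
  intro x hx z hz h
  have hA := Ico_subset_Iio p n
  obtain ⟨y, hy, hc, hno⟩ := B.exists_isStrip hA hx.1
  obtain ⟨y', hy', hc', hno'⟩ := B.exists_isStrip hA hz.1
  obtain ⟨a, ha, b, hb, e, -⟩ := B.exists_frac_Ico (s := s) (n := n) (q := p) (g := y⁻¹ * y') (by
    have := mul_mem (mul_mem (Mon.le_Grp s _ hc) h) (inv_mem (Mon.le_Grp s _ hc'))
    simpa [mul_assoc] using this)
  have e' : y * a = y' * b := by
    rw [eq_mul_inv_iff_mul_eq, mul_assoc, inv_mul_eq_iff_eq_mul] at e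
    exact e.symm
  obtain rfl : y = y' := B.isStrip_unique hA (x := y * a) (NoTail.isStrip_mul hy hno ha)
    (by rw [e']; exact NoTail.isStrip_mul hy' hno' hb)
  have hyD : y ∈ Dv s n w := Dv.of_mul hy (Mon.mono s hA hc) (by simpa using hx)
  obtain ⟨k, hk, hk₁, hk₂⟩ := B.exists_head hA hyD.2
  have ht : y * k ∈ Dv s n w := ⟨mul_mem hy (Mon.mono s hA hk), by simpa [mul_assoc] using hk₁⟩
  have key : ∀ x ∈ Dv s n w, y⁻¹ * x ∈ Mon s (Set.Ico p n) → WPath s n w p x (y * k) := by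
    intro x hx hc
    have := hk₂ _ hc (by simpa [mul_assoc] using hx.2)
    have := WPath.of_mul (w := w) hx.1 this (by simpa [mul_assoc] using ht)
    simpa [mul_assoc] using this
  exact B.compare_below ih ht x hx z hz (key x hx hc) (key z hz hc')

theorem sig_trichotomy (B : BraidLike s n) {p : ℕ} {α : Γ} (h : α ∈ Grp s (Set.Ico p n)) :
    α ∈ Sig s n p ∨ α⁻¹ ∈ Sig s n p ∨ α ∈ Grp s (Set.Ico (p + 1) n) := by
  obtain ⟨c, hc, d, hd, rfl, hcd⟩ := B.exists_frac_Ico h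
  have hc' := Mon.mono s (Ico_subset_Iio p n) hc
  have hd' := Mon.mono s (Ico_subset_Iio p n) hd
  rw [hcd.inv_right.eq] at h ⊢
  rcases B.compare (c * d) p d ⟨hd', by rwa [hcd.eq, inv_mul_cancel_left]⟩ c
    ⟨hc', by rwa [inv_mul_cancel_left]⟩ h with h | h | h
  · exact .inl h.sig
  · exact .inr (.inl (by simpa using h.sig))
  · exact .inr (.inr h)

end BraidLike

end BraidWord

/-! ### The positive cones -/

namespace BraidWord

open GarsideOrder BraidOrder

theorem mi_eq (n p : ℕ) : Mi n p = Mon (gen n) (Set.Ico p n) := by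
  rw [Mi, Mon]
  congr 1
  ext x
  simp [and_assoc, eq_comm]

theorem ni_eq (n p : ℕ) : Ni n (p + 1) = Mon (gen n) (Set.Ico p (n - 1)) := by
  rw [Ni, Mon]
  congr 1
  ext x
  simp [and_assoc, eq_comm, Nat.lt_sub_iff_add_lt]

theorem seg_eq {n p : ℕ} {b : ℕ} (h : p ≤ b) :
    seg n p b = asc (fun i => gen n (p + i)) (b - p) := by
  induction b, h using Nat.le_induction with
  | base => simp [seg, asc, List.drop_eq_nil_of_le]
  | succ b h ih =>
    rw [Nat.sub_add_comm h, asc, ← ih, seg, seg, List.range_succ,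
      List.drop_append_of_le_length (by simpa using h)]
    simp [Nat.add_sub_cancel' h]

theorem piSet_eq {n p : ℕ} (hp : p < n) : PiSet n (p + 1) = Sig (gen n) n p := by
  have B := braidLike_gen n
  rcases Nat.lt_or_ge (p + 1) n with h | h
  · have e₁ : Mi n p = Mon (fun i => gen n (p + i)) (Set.Iio (n - p)) := by
      rw [mi_eq, Mon.comp (gen n) (fun i => p + i), image_add_Iio]
    have e₂ : Mi n (p + 1) = Mon (fun i => gen n (p + i)) (Set.Ico 1 (n - p)) := by
      rw [mi_eq, Mon.comp (gen n) (fun i => p + i), image_add_Ico]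
    have e₃ : Ni n (p + 1) = Mon (fun i => gen n (p + i)) (Set.Iio (n - p - 1)) := by
      rw [ni_eq, Mon.comp (gen n) (fun i => p + i), Nat.sub_right_comm, image_add_Iio]
    have e₄ : Δi n p = gar (fun i => gen n (p + i)) (n - p) := by
      rw [Δi, seg_eq hp.le, gar, Nat.sub_add_comm hp.le]
    ext α
    rw [PiSet, if_neg h.ne, Nat.add_sub_cancel, Set.mem_ofPred_eq, e₁, e₂, e₃, e₄,
      (B.shift p).negative_iff_sig (by omega), Sig.shift]
    rfl
  · obtain rfl : n = p + 1 := by omega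
    have hbot : Grp (gen (p + 1)) (Set.Ico (p + 1) (p + 1)) = ⊥ := by
      rw [Set.Ico_self, Grp, Set.image_empty, Subgroup.closure_empty]
    rw [PiSet, if_pos rfl, Nat.add_sub_cancel]
    ext x
    have hs : gen (p + 1) p ∈ Sig (gen (p + 1)) (p + 1) p := by
      simpa using Sig.gen_mem (s := gen (p + 1)) (n := p + 1) (p := p) (one_mem _) (one_mem _)
    constructor
    · rintro ⟨k, hk, rfl⟩
      induction k, hk using Nat.le_induction with
      | base => rwa [pow_one]
      | succ k _ ih => rw [pow_succ]; exact (Sig _ _ p).mul_mem ih hs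
    · intro hx
      induction hx using Subsemigroup.closure_induction with
      | mem x hx =>
        obtain ⟨g, hg, h, hh, rfl⟩ := hx
        rw [hbot, Subgroup.mem_bot] at hg hh
        exact ⟨1, le_rfl, by simp [hg, hh]⟩
      | mul x y _ _ hx hy =>
        obtain ⟨k, hk, rfl⟩ := hx
        obtain ⟨l, hl, rfl⟩ := hy
        exact ⟨k + l, by omega, (pow_add _ _ _).symm⟩

variable {Γ : Type*} [Group Γ] {s : ℕ → Γ} {n : ℕ}

theorem Sig.le_Grp {p : ℕ} (hp : p < n) {x : Γ} (hx : x ∈ Sig s n p) :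
    x ∈ Grp s (Set.Ico p n) := by
  induction hx using Subsemigroup.closure_induction with
  | mem x hx =>
    obtain ⟨g, hg, h, hh, rfl⟩ := hx
    exact mul_mem (mul_mem (Grp.mono s (Ico_succ_subset p n) hg) (Grp.gen_mem s ⟨le_rfl, hp⟩))
      (Grp.mono s (Ico_succ_subset p n) hh)
  | mul x y _ _ hx hy => exact mul_mem hx hy

/-- The elements of level `p` with the sign prescribed by `e`. -/
def SSig (s : ℕ → Γ) (n : ℕ) (e : Bool) (p : ℕ) : Set Γ :=
  if e then Sig s n p else {x | x⁻¹ ∈ Sig s n p}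

theorem SSig.mul {e : Bool} {p : ℕ} {x y : Γ} (hx : x ∈ SSig s n e p) (hy : y ∈ SSig s n e p) :
    x * y ∈ SSig s n e p := by
  cases e
  · simpa [SSig] using (Sig s n p).mul_mem hy hx
  · exact (Sig s n p).mul_mem hx hy

theorem SSig.mul_left {e : Bool} {p : ℕ} {g x : Γ} (hg : g ∈ Grp s (Set.Ico (p + 1) n))
    (hx : x ∈ SSig s n e p) : g * x ∈ SSig s n e p := by
  cases e
  · simpa [SSig] using Sig.mul_right (inv_mem hg) hx
  · exact Sig.mul_left hg hx

theorem SSig.mul_right {e : Bool} {p : ℕ} {g x : Γ} (hg : g ∈ Grp s (Set.Ico (p + 1) n))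
    (hx : x ∈ SSig s n e p) : x * g ∈ SSig s n e p := by
  cases e
  · simpa [SSig] using Sig.mul_left (inv_mem hg) hx
  · exact Sig.mul_right hg hx

theorem SSig.le_Grp {e : Bool} {p q : ℕ} (hq : q < n) (hp : p < q) {x : Γ}
    (hx : x ∈ SSig s n e q) : x ∈ Grp s (Set.Ico (p + 1) n) := by
  refine Grp.mono s (Set.Ico_subset_Ico_left hp) ?_
  cases e
  · simpa using inv_mem (Sig.le_Grp hq hx)
  · exact Sig.le_Grp hq hx

namespace BraidLike

theorem one_notMem_sSig (B : BraidLike s n)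
    {e : Bool} {p : ℕ} (hp : p < n) : (1 : Γ) ∉ SSig s n e p := by
  cases e
  · simpa [SSig] using B.one_notMem_sig' hp
  · exact B.one_notMem_sig' hp

theorem sSig_trichotomy (B : BraidLike s n) (e : ℕ → Bool) {x : Γ} (hx : x ∈ Grp s (Set.Iio n)) :
    (∃ p < n, x ∈ SSig s n (e p) p) ∨ (∃ p < n, x⁻¹ ∈ SSig s n (e p) p) ∨ x = 1 := by
  by_contra! h
  have key : ∀ p ≤ n, x ∈ Grp s (Set.Ico p n) := by
    intro p hp
    induction p with
    | zero => exact Grp.mono s (B := Set.Ico 0 n) (fun i hi => ⟨i.zero_le, hi⟩) hx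
    | succ p ih =>
      have h₁ := h.1 p hp
      have h₂ := h.2.1 p hp
      rcases B.sig_trichotomy (ih (by omega)) with h' | h' | h'
      · cases he : e p <;> simp_all [SSig]
      · cases he : e p <;> simp_all [SSig]
      · exact h'
  have := key n le_rfl
  rw [Set.Ico_self, Grp, Set.image_empty, Subgroup.closure_empty, Subgroup.mem_bot] at this
  exact h.2.2 this

end BraidLike

theorem sSig_mul (e : ℕ → Bool) {p q : ℕ} (hp : p < n) (hq : q < n) {x y : Γ}
    (hx : x ∈ SSig s n (e p) p) (hy : y ∈ SSig s n (e q) q) :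
    ∃ r < n, x * y ∈ SSig s n (e r) r := by
  rcases lt_trichotomy p q with h | rfl | h
  · exact ⟨p, hp, SSig.mul_right (SSig.le_Grp hq h hy) hx⟩
  · exact ⟨p, hp, SSig.mul hx hy⟩
  · exact ⟨q, hq, SSig.mul_left (SSig.le_Grp hp h hx) hy⟩

theorem grp_gen_eq_top (n : ℕ) : Grp (gen n) (Set.Iio n) = ⊤ := by
  rw [eq_top_iff, ← PresentedGroup.closure_range_of, Grp, Subgroup.closure_le]
  rintro _ ⟨i, rfl⟩
  rw [← gen_of_lt i.2]
  exact Grp.gen_mem (gen n) i.2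

theorem mem_cone_iff {n : ℕ} {ε : ℕ → Bool} {x : Braid n} :
    x ∈ (⋃ i ∈ Finset.Icc 1 n, (if ε i then PiSet n i else {x : Braid n | x⁻¹ ∈ PiSet n i})) ↔
      ∃ p < n, x ∈ SSig (gen n) n (ε (p + 1)) p := by
  simp only [Set.mem_iUnion, Finset.mem_Icc, exists_prop]
  constructor
  · rintro ⟨i, hi, hx⟩
    obtain ⟨p, rfl⟩ : ∃ p, i = p + 1 := ⟨i - 1, by omega⟩
    rw [piSet_eq hi.2] at hx
    exact ⟨p, hi.2, hx⟩
  · rintro ⟨p, hp, hx⟩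
    refine ⟨p + 1, ⟨by omega, hp⟩, ?_⟩
    rw [piSet_eq hp]
    exact hx

end BraidWord

open GarsideOrder BraidOrder in
/-- For every `ε ∈ {1, -1}^n`, the set `P^ε = P_1^{ε_1} ∪ ⋯ ∪ P_n^{ε_n}` is the positive
cone of a left-order on `B_{n+1}`. -/
theorem statement11 (n : ℕ) (hn : 2 ≤ n) (ε : ℕ → Bool) (Pε : Set (Braid n))
    (hPε : Pε = ⋃ i ∈ Finset.Icc 1 n,
      (if ε i then PiSet n i else {x : Braid n | x⁻¹ ∈ PiSet n i})) :
    (∀ x : Braid n, x ∈ Pε ∨ x⁻¹ ∈ Pε ∨ x = 1) ∧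
    (∀ x : Braid n, ¬(x ∈ Pε ∧ x⁻¹ ∈ Pε)) ∧
    (1 : Braid n) ∉ Pε ∧
    (∀ x ∈ Pε, ∀ y ∈ Pε, x * y ∈ Pε) := by
  have B := BraidWord.braidLike_gen n
  have mem : ∀ x, x ∈ Pε ↔ ∃ p < n, x ∈ BraidWord.SSig (gen n) n (ε (p + 1)) p := fun x => by
    rw [hPε, BraidWord.mem_cone_iff]
  have one : (1 : Braid n) ∉ Pε := fun h => by
    obtain ⟨p, hp, h⟩ := (mem 1).1 h
    exact B.one_notMem_sSig hp h
  have mul : ∀ x ∈ Pε, ∀ y ∈ Pε, x * y ∈ Pε := fun x hx y hy => by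
    obtain ⟨p, hp, hx⟩ := (mem x).1 hx
    obtain ⟨q, hq, hy⟩ := (mem y).1 hy
    exact (mem _).2 (BraidWord.sSig_mul (fun p => ε (p + 1)) hp hq hx hy)
  refine ⟨fun x => ?_, fun x h => one ?_, one, mul⟩
  · rw [mem, mem]
    exact B.sSig_trichotomy (fun p => ε (p + 1))
      (by rw [BraidWord.grp_gen_eq_top]; exact Subgroup.mem_top x)
  · simpa using mul x h.1 _ h.2
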